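/- If a 3-connected graph contains two vertex-disjoint cycles, one of even length and one of odd length, then it contains two cycles of consecutive even lengths. -/

import Mathlib

open SimpleGraph

/-- `G` contains two cycles of consecutive even lengths `2m` and `2m+2`. -/
def HasTwoConsecEvenCycles {V : Type*} (G : SimpleGraph V) : Prop :=
  ∃ (u v : V) (c₁ : G.Walk u u) (c₂ : G.Walk v v) (m : ℕ),
    c₁.IsCycle ∧ c₂.IsCycle ∧ 0 < m ∧ c₁.length = 2 * m ∧ c₂.length = 2 * m + 2

/-- `G` is `k`-connected: more than `k` vertices, and deleting any set of
fewer than `k` vertices leaves a connected graph. -/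
def KConnected {V : Type*} (k : ℕ) (G : SimpleGraph V) : Prop :=
  k + 1 ≤ Nat.card V ∧ ∀ S : Set V, S.ncard < k → (G.induce Sᶜ).Connected


namespace ConsecEven

variable {V : Type*} {G : SimpleGraph V}

/-- There is a path from `x` to `y` of length `n` with all vertices in `S`. -/
def PIn (G : SimpleGraph V) (S : Set V) (x y : V) (n : ℕ) : Prop :=
  ∃ p : G.Walk x y, p.IsPath ∧ p.length = n ∧ ∀ v ∈ p.support, v ∈ S

/-- There is a walk from `x` to `y` with all vertices in `S`. -/
inductive WIn (G : SimpleGraph V) (S : Set V) : V → V → Prop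
  | refl {x : V} : x ∈ S → WIn G S x x
  | step {x y z : V} : x ∈ S → G.Adj x y → WIn G S y z → WIn G S x z

lemma PIn.refl {S : Set V} {x : V} (h : x ∈ S) : PIn G S x x 0 :=
  ⟨.nil, by simp, by simp, by simpa using h⟩

lemma PIn.mono {S S' : Set V} {x y : V} {n : ℕ} (h : PIn G S x y n) (hs : S ⊆ S') :
    PIn G S' x y n := by
  obtain ⟨p, hp, hl, hS⟩ := h
  exact ⟨p, hp, hl, fun v hv => hs (hS v hv)⟩

lemma PIn.symm {S : Set V} {x y : V} {n : ℕ} (h : PIn G S x y n) : PIn G S y x n := by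
  obtain ⟨p, hp, hl, hS⟩ := h
  exact ⟨p.reverse, hp.reverse, by simpa using hl, by simpa using hS⟩

lemma PIn.left_mem {S : Set V} {x y : V} {n : ℕ} (h : PIn G S x y n) : x ∈ S := by
  obtain ⟨p, hp, hl, hS⟩ := h
  exact hS _ p.start_mem_support

lemma PIn.right_mem {S : Set V} {x y : V} {n : ℕ} (h : PIn G S x y n) : y ∈ S :=
  h.symm.left_mem

lemma PIn.append {S S' : Set V} {x y z : V} {n m : ℕ} (h : PIn G S x y n) (h' : PIn G S' y z m)
    (hd : ∀ v ∈ S, v ∈ S' → v = y) : PIn G (S ∪ S') x z (n + m) := by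
  obtain ⟨p, hp, hl, hS⟩ := h
  obtain ⟨q, hq, hl', hS'⟩ := h'
  refine ⟨p.append q, ?_, by simp [hl, hl'], ?_⟩
  · rw [SimpleGraph.Walk.isPath_def, SimpleGraph.Walk.support_append, List.nodup_append']
    refine ⟨hp.support_nodup, hq.support_nodup.tail, ?_⟩
    intro v hv hv'
    have h1 := hd v (hS v hv) (hS' v (List.mem_of_mem_tail hv'))
    subst h1
    have := hq.support_nodup
    rw [← SimpleGraph.Walk.cons_tail_support, List.nodup_cons] at this
    exact this.1 hv'
  · intro v hv
    rw [SimpleGraph.Walk.mem_support_append_iff] at hv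
    rcases hv with hv | hv
    · exact Or.inl (hS v hv)
    · exact Or.inr (hS' v hv)

lemma PIn.cons {S : Set V} {x y z : V} {m : ℕ} (hxy : G.Adj x y)
    (h' : PIn G S y z m) (hd : x ∉ S) : PIn G (insert x S) x z (m + 1) := by
  obtain ⟨q, hq, hl', hS'⟩ := h'
  refine ⟨.cons hxy q, hq.cons (fun h => hd (hS' _ h)), by simp [hl'], ?_⟩
  intro v hv
  rw [SimpleGraph.Walk.support_cons, List.mem_cons] at hv
  rcases hv with hv | hv
  · exact Or.inl hv
  · exact Or.inr (hS' v hv)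

lemma PIn.join {S S' : Set V} {x y y' z : V} {n m : ℕ} (h : PIn G S x y n) (hyy : G.Adj y y')
    (h' : PIn G S' y' z m) (hd : ∀ v ∈ S, v ∉ S') : PIn G (S ∪ S') x z (n + m + 1) := by
  have h1 := PIn.cons hyy h' (hd y h.right_mem)
  have h2 := h.append h1 (by
    intro v hv hv'
    rcases hv' with hv' | hv'
    · exact hv'
    · exact absurd hv' (hd v hv))
  have h3 := h2.mono (S' := S ∪ S') (by
    intro v hv
    rcases hv with hv | hv | hv
    · exact Or.inl hv
    · subst hv; exact Or.inl h.right_mem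
    · exact Or.inr hv)
  rwa [← add_assoc] at h3

lemma WIn.of_walk {S : Set V} {x y : V} (p : G.Walk x y) (h : ∀ v ∈ p.support, v ∈ S) :
    WIn G S x y := by
  induction p with
  | nil => exact .refl (h _ (by simp))
  | cons hxy p ih =>
    exact .step (h _ (by simp)) hxy (ih fun v hv => h v (by simp [hv]))

lemma WIn.exists_walk {S : Set V} {x y : V} (h : WIn G S x y) :
    ∃ p : G.Walk x y, ∀ v ∈ p.support, v ∈ S := by
  induction h with
  | refl h => exact ⟨.nil, by simpa using h⟩
  | step hx hxy _ ih =>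
    obtain ⟨p, hp⟩ := ih
    refine ⟨.cons hxy p, ?_⟩
    intro v hv
    rw [SimpleGraph.Walk.support_cons, List.mem_cons] at hv
    rcases hv with hv | hv
    · exact hv ▸ hx
    · exact hp v hv

lemma WIn.exists_PIn {S : Set V} {x y : V} (h : WIn G S x y) : ∃ n, PIn G S x y n := by
  classical
  obtain ⟨p, hp⟩ := h.exists_walk
  exact ⟨_, p.bypass, p.bypass_isPath, rfl,
    fun v hv => hp v (p.support_bypass_subset_support hv)⟩

lemma PIn.toWIn {S : Set V} {x y : V} {n : ℕ} (h : PIn G S x y n) : WIn G S x y := by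
  obtain ⟨p, hp, hl, hS⟩ := h
  exact .of_walk p hS

lemma WIn.mono {S S' : Set V} {x y : V} (h : WIn G S x y) (hs : S ⊆ S') : WIn G S' x y := by
  induction h with
  | refl h => exact .refl (hs h)
  | step hx hxy _ ih => exact .step (hs hx) hxy ih

lemma WIn.left_mem {S : Set V} {x y : V} (h : WIn G S x y) : x ∈ S := by
  cases h <;> assumption

lemma WIn.trans {S : Set V} {x y z : V} (h : WIn G S x y) (h' : WIn G S y z) : WIn G S x z := by
  induction h with
  | refl h => exact h'
  | step hx hxy _ ih => exact .step hx hxy (ih h')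

lemma WIn.symm {S : Set V} {x y : V} (h : WIn G S x y) : WIn G S y x := by
  induction h with
  | refl h => exact .refl h
  | step hx hxy h2 ih => exact ih.trans (.step h2.left_mem hxy.symm (.refl hx))

lemma WIn.right_mem {S : Set V} {x y : V} (h : WIn G S x y) : y ∈ S := h.symm.left_mem

/-- Everything on a walk from `x` is reachable from `x`. -/
lemma WIn.self {S : Set V} {x y : V} (h : WIn G S x y) : WIn G {v | WIn G S x v} x y := by
  have key : ∀ {a b : V}, WIn G S a b → WIn G S x a → WIn G {v | WIn G S x v} a b := by
    intro a b hab
    induction hab with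
    | refl h => intro hx; exact .refl hx
    | step ha hac hcb ih =>
      intro hx
      exact .step hx hac (ih (hx.trans (.step ha hac (.refl hcb.left_mem))))
  exact key h (.refl h.left_mem)

/-- Going until the first vertex of `B`. -/
lemma WIn.first {S B : Set V} {x y : V} (h : WIn G S x y) (hy : y ∈ B) (hx : x ∉ B) :
    ∃ a b, WIn G (S \ B) x a ∧ G.Adj a b ∧ b ∈ B ∧ b ∈ S := by
  induction h with
  | refl h => exact absurd hy hx
  | @step x' y' z' hxS hxy hyz ih =>
    by_cases hyB : y' ∈ B
    · exact ⟨x', y', .refl ⟨hxS, hx⟩, hxy, hyB, hyz.left_mem⟩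
    · obtain ⟨a, b, hw, h2⟩ := ih hy hyB
      exact ⟨a, b, .step ⟨hxS, hx⟩ hxy hw, h2⟩

/-- Combining two internally disjoint paths into a cycle. -/
lemma PIn.cycle {S S' : Set V} {x y : V} {n m : ℕ} (h : PIn G S x y n) (h' : PIn G S' x y m)
    (hd : ∀ v ∈ S, v ∈ S' → v = x ∨ v = y) (hnm : 1 < n ∨ 1 < m) :
    ∃ w : G.Walk x x, w.IsCycle ∧ w.length = n + m ∧ ∀ v ∈ w.support, v ∈ S ∪ S' := by
  obtain ⟨p, hp, hl, hS⟩ := h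
  obtain ⟨q, hq, hl', hS'⟩ := h'
  refine ⟨p.append q.reverse, ?_, by simp [hl, hl'], ?_⟩
  · refine hp.isCycle_append hq.reverse ?_ (by simpa [hl, hl'] using hnm)
    intro v hv hv'
    have h1 := hS v (List.mem_of_mem_tail hv)
    have h2 := hS' v (by simpa using List.mem_of_mem_tail hv')
    rcases hd v h1 h2 with rfl | rfl
    · have := hp.support_nodup
      rw [← SimpleGraph.Walk.cons_tail_support, List.nodup_cons] at this
      exact this.1 hv
    · have := hq.reverse.support_nodup
      rw [← SimpleGraph.Walk.cons_tail_support, List.nodup_cons] at this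
      exact this.1 hv'
  · intro v hv
    rw [SimpleGraph.Walk.mem_support_append_iff] at hv
    rcases hv with hv | hv
    · exact Or.inl (hS v hv)
    · exact Or.inr (hS' v (by simpa using hv))

/-- Closing a path by an edge. -/
lemma PIn.close {S : Set V} {x y : V} {n : ℕ} (h : PIn G S x y n) (hyx : G.Adj y x)
    (hn : 1 < n) :
    ∃ w : G.Walk x x, w.IsCycle ∧ w.length = n + 1 ∧ ∀ v ∈ w.support, v ∈ S := by
  have h2 : PIn G {x, y} x y 1 := by
    have := PIn.cons (S := {y}) hyx.symm (PIn.refl rfl) (by simpa using hyx.ne')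
    simpa using this
  obtain ⟨w, hw, hl, hS⟩ := h.cycle h2 (by simp) (Or.inl hn)
  refine ⟨w, hw, hl, fun v hv => ?_⟩
  rcases hS v hv with h' | h' | h'
  · exact h'
  · exact h' ▸ h.left_mem
  · rw [Set.mem_singleton_iff] at h'
    exact h' ▸ h.right_mem

/-- Path along a window of an injective-on-window sequence. -/
lemma PIn.window (g : ℕ → V) (i k : ℕ) (hadj : ∀ j, i ≤ j → j < i + k → G.Adj (g j) (g (j + 1)))
    (hinj : ∀ a b, i ≤ a → a < b → b ≤ i + k → g a ≠ g b) :
    PIn G {v | ∃ j, i ≤ j ∧ j ≤ i + k ∧ v = g j} (g i) (g (i + k)) k := by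
  induction k with
  | zero => exact PIn.refl ⟨i, le_rfl, le_rfl, rfl⟩
  | succ k ih =>
    have h1 := ih (fun j h1 h2 => hadj j h1 (by omega)) (fun a b h1 h2 h3 => hinj a b h1 h2 (by omega))
    have h2 := h1.join (S' := {g (i + k + 1)}) (hadj (i + k) (by omega) (by omega))
      (PIn.refl rfl) (by
        rintro v ⟨j, hj1, hj2, rfl⟩ hv
        exact hinj j (i + k + 1) hj1 (by omega) (by omega) hv)
    refine h2.mono ?_
    rintro v (⟨j, hj1, hj2, rfl⟩ | hv)
    · exact ⟨j, hj1, by omega, rfl⟩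
    · exact ⟨i + k + 1, by omega, by omega, hv⟩

/-- A cyclically parametrised cycle. -/
structure Cyc (G : SimpleGraph V) (n : ℕ) (c : ℕ → V) : Prop where
  three : 3 ≤ n
  per : ∀ i, c (i + n) = c i
  adj : ∀ i, G.Adj (c i) (c (i + 1))
  inj : ∀ i j, i < j → j < i + n → c i ≠ c j

lemma Cyc.arc {n : ℕ} {c : ℕ → V} (h : Cyc G n c) (i k : ℕ) (hk : k < n) :
    PIn G {v | ∃ j, i ≤ j ∧ j ≤ i + k ∧ v = c j} (c i) (c (i + k)) k :=
  PIn.window c i k (fun j _ _ => h.adj j) (fun a b _ _ _ => h.inj a b (by omega) (by omega))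

lemma per_mul {n : ℕ} {c : ℕ → V} (h : ∀ i, c (i + n) = c i) (i k : ℕ) : c (i + n * k) = c i := by
  induction k with
  | zero => simp
  | succ k ih => rw [Nat.mul_succ, ← add_assoc, h, ih]

/-- Every vertex has an index in any window. -/
lemma per_window {n : ℕ} {c : ℕ → V} (hn : 0 < n) (h : ∀ i, c (i + n) = c i) (p j : ℕ) :
    ∃ j', p ≤ j' ∧ j' < p + n ∧ c j' = c j := by
  have hm := Nat.mod_lt (j + n * p - p) hn
  have hp : p ≤ n * p := Nat.le_mul_of_pos_left p hn
  refine ⟨p + (j + n * p - p) % n, by omega, by omega, ?_⟩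
  have h1 := Nat.mod_add_div (j + n * p - p) n
  have h2 := per_mul h (p + (j + n * p - p) % n) ((j + n * p - p) / n)
  rw [← h2, add_assoc, h1, show p + (j + n * p - p) = j + n * p by omega, per_mul h]

lemma Cyc.window {n : ℕ} {c : ℕ → V} (h : Cyc G n c) (p j : ℕ) :
    ∃ j', p ≤ j' ∧ j' < p + n ∧ c j' = c j :=
  per_window (by have := h.three; omega) h.per p j

/-- Cyclic parametrisation of a closed walk. -/
lemma closed_walk {u : V} (w : G.Walk u u) (hw : 0 < w.length) :
    (∀ i, w.getVert ((i + w.length) % w.length) = w.getVert (i % w.length)) ∧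
    (∀ i, G.Adj (w.getVert (i % w.length)) (w.getVert ((i + 1) % w.length))) := by
  refine ⟨fun i => by simp, fun i => ?_⟩
  have h1 := Nat.mod_lt i hw
  have h2 := w.adj_getVert_succ h1
  by_cases h : i % w.length + 1 = w.length
  · have : (i + 1) % w.length = 0 := by
      rw [Nat.add_mod_eq_ite]
      by_cases h1 : w.length = 1
      · simp [h1, Nat.mod_one]
      · rw [Nat.mod_eq_of_lt (show 1 < w.length by omega)]
        simp [h]
    rw [this, SimpleGraph.Walk.getVert_zero]
    rwa [h, SimpleGraph.Walk.getVert_length] at h2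
  · have : (i + 1) % w.length = i % w.length + 1 := by
      rw [Nat.add_mod_eq_ite, Nat.mod_eq_of_lt (show 1 < w.length by omega)]
      rw [if_neg (by omega)]
    rwa [this]

lemma Cyc.of_walk {u : V} (w : G.Walk u u) (hw : w.IsCycle) :
    Cyc G w.length (fun i => w.getVert (i % w.length)) ∧
      ∀ v, v ∈ w.support ↔ ∃ i, v = w.getVert (i % w.length) := by
  have h3 := hw.three_le_length
  obtain ⟨h1, h2⟩ := closed_walk w (by omega)
  refine ⟨⟨h3, h1, h2, ?_⟩, ?_⟩
  · intro i j hij hji heq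
    have hi := Nat.mod_lt i (show 0 < w.length by omega)
    have hj := Nat.mod_lt j (show 0 < w.length by omega)
    have h4 := hw.getVert_injOn' (show i % w.length ≤ w.length - 1 by omega)
      (show j % w.length ≤ w.length - 1 by omega) heq
    have h5 := (Nat.modEq_iff_dvd' hij.le).mp h4
    have := Nat.le_of_dvd (by omega) h5
    omega
  · intro v
    rw [SimpleGraph.Walk.mem_support_iff_exists_getVert]
    constructor
    · rintro ⟨k, hk, hkl⟩
      by_cases h : k = w.length
      · refine ⟨0, ?_⟩
        rw [← hk, h]; simp
      · exact ⟨k, by rw [Nat.mod_eq_of_lt (by omega)]; exact hk.symm⟩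
    · rintro ⟨i, rfl⟩
      exact ⟨_, rfl, (Nat.mod_lt i (by omega)).le⟩

/-- An odd closed sequence inside `Y` contains an odd cycle. -/
lemma odd_cyc {Y : Set V} (n : ℕ) : ∀ (c : ℕ → V), n % 2 = 1 → (∀ i, c (i + n) = c i) →
    (∀ i, G.Adj (c i) (c (i + 1))) → (∀ i, c i ∈ Y) →
    ∃ n' c', n' % 2 = 1 ∧ Cyc G n' c' ∧ ∀ i, c' i ∈ Y := by
  induction n using Nat.strong_induction_on with
  | _ n ih =>
    intro c hn hper hadj hY
    by_cases hinj : ∀ i j, i < j → j < i + n → c i ≠ c j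
    · refine ⟨n, c, hn, ⟨?_, hper, hadj, hinj⟩, hY⟩
      by_contra h
      have h1 : n = 1 := by omega
      subst h1
      have := hadj 0
      rw [hper 0] at this
      exact this.ne rfl
    · push Not at hinj
      obtain ⟨i, j, hij, hji, heq⟩ := hinj
      -- restart on a shorter closed sequence from a to b
      have key : ∀ a b, a < b → b < a + n → (b - a) % 2 = 1 → c a = c b →
          ∃ n' c', n' % 2 = 1 ∧ Cyc G n' c' ∧ ∀ i, c' i ∈ Y := by
        intro a b hab hba hodd hc
        refine ih (b - a) (by omega) (fun k => c (a + k % (b - a))) hodd (by simp) ?_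
          (fun _ => hY _)
        intro k
        have hk := Nat.mod_lt k (show 0 < b - a by omega)
        by_cases h : k % (b - a) + 1 = b - a
        · have : (k + 1) % (b - a) = 0 := by
            rw [Nat.add_mod_eq_ite]
            by_cases h1 : b - a = 1
            · simp [h1, Nat.mod_one]
            · rw [Nat.mod_eq_of_lt (show 1 < b - a by omega)]
              simp [h]
          simp only [this]
          have h2 := hadj (a + k % (b - a))
          rw [add_assoc, h, show a + (b - a) = b by omega, ← hc] at h2
          exact h2
        · have : (k + 1) % (b - a) = k % (b - a) + 1 := by
            rw [Nat.add_mod_eq_ite, Nat.mod_eq_of_lt (show 1 < b - a by omega),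
              if_neg (by omega)]
          simp only [this]
          exact hadj _
      by_cases hodd : (j - i) % 2 = 1
      · exact key i j hij hji hodd heq
      · exact key j (i + n) hji (by omega) (by omega) (by rw [hper]; exact heq.symm)

/-- Any two distinct vertices are joined by paths of both parities. -/
def Rich (G : SimpleGraph V) (B : Set V) : Prop :=
  ∀ x ∈ B, ∀ y ∈ B, x ≠ y → ∀ e : ℕ, ∃ n, n % 2 = e % 2 ∧ PIn G B x y n

lemma Rich.of_cyc {n : ℕ} {c : ℕ → V} (h : Cyc G n c) (hn : n % 2 = 1) : Rich G (Set.range c) := by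
  rintro x ⟨i, rfl⟩ y ⟨j, rfl⟩ hxy e
  obtain ⟨j', h1, h2, h3⟩ := h.window i j
  rw [← h3] at hxy ⊢
  have hne : i ≠ j' := fun h => hxy (by rw [h])
  by_cases hp : (j' - i) % 2 = e % 2
  · refine ⟨j' - i, hp, ?_⟩
    have := h.arc i (j' - i) (by omega)
    rw [show i + (j' - i) = j' by omega] at this
    refine this.mono ?_
    rintro v ⟨k, _, _, rfl⟩
    exact ⟨k, rfl⟩
  · refine ⟨n - (j' - i), by omega, ?_⟩
    have := h.arc j' (n - (j' - i)) (by omega)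
    rw [show j' + (n - (j' - i)) = i + n by omega, h.per] at this
    refine this.symm.mono ?_
    rintro v ⟨k, _, _, rfl⟩
    exact ⟨k, rfl⟩

lemma Rich.ear {B S : Set V} (hB : Rich G B) {b1 b2 x1 x2 : V} {L : ℕ} (h1 : b1 ∈ B) (h2 : b2 ∈ B)
    (hne : b1 ≠ b2) (hp : PIn G S x1 x2 L) (hS : ∀ v ∈ S, v ∉ B) (ha1 : G.Adj x1 b1)
    (ha2 : G.Adj x2 b2) : ∃ B', Rich G B' ∧ B ⊆ B' ∧ x1 ∈ B' ∧ B' ⊆ B ∪ S := by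
  obtain ⟨p, hp, hl, hpS⟩ := hp
  set g := p.getVert with hg
  have g0 : g 0 = x1 := by simp [hg]
  have gL : g L = x2 := by rw [hg, ← hl]; simp
  have hinj : ∀ a b, a < b → b ≤ L → g a ≠ g b := by
    intro a b hab hbL heq
    have := hp.getVert_injOn (show a ≤ p.length by omega) (show b ≤ p.length by omega) heq
    omega
  have gS : ∀ k, g k ∈ S := fun k => hpS _ (p.getVert_mem_support k)
  have gB : ∀ k, g k ∉ B := fun k => hS _ (gS k)
  have gw : ∀ i j, i ≤ j → j ≤ L →
      PIn G {v | ∃ k, i ≤ k ∧ k ≤ j ∧ v = g k} (g i) (g j) (j - i) := by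
    intro i j hij hj
    have := PIn.window (G := G) g i (j - i) (fun k _ hk => p.adj_getVert_succ (by omega))
      (fun a b _ hab hb => hinj a b hab (by omega))
    rwa [show i + (j - i) = j by omega] at this
  -- paths from the ear to a vertex of `B`
  have toB : ∀ k ≤ L, ∀ y ∈ B, ∀ e : ℕ, ∃ n, n % 2 = e % 2 ∧
      PIn G (B ∪ {v | ∃ k, k ≤ L ∧ v = g k}) (g k) y n := by
    intro k hk y hy e
    by_cases hy1 : b1 = y
    · have hy2 : b2 ≠ y := fun h => hne (hy1.trans h.symm)
      obtain ⟨n, hn, hpn⟩ := hB b2 h2 y hy hy2 (e + (L - k) + 1)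
      have h3 := (gw k L hk le_rfl).join (gL ▸ ha2) hpn (by
        rintro v ⟨l, _, _, rfl⟩; exact gB l)
      refine ⟨_, ?_, h3.mono ?_⟩
      · omega
      · rintro v (⟨l, _, _, rfl⟩ | hv)
        · exact Or.inr ⟨l, by omega, rfl⟩
        · exact Or.inl hv
    · obtain ⟨n, hn, hpn⟩ := hB b1 h1 y hy hy1 (e + k + 1)
      have h3 := (gw 0 k (by omega) hk).symm.join (g0 ▸ ha1) hpn (by
        rintro v ⟨l, _, _, rfl⟩; exact gB l)
      refine ⟨_, ?_, h3.mono ?_⟩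
      · omega
      · rintro v (⟨l, _, _, rfl⟩ | hv)
        · exact Or.inr ⟨l, by omega, rfl⟩
        · exact Or.inl hv
  have ear2 : ∀ k l, k < l → l ≤ L → ∀ e : ℕ, ∃ n, n % 2 = e % 2 ∧
      PIn G (B ∪ {v | ∃ k, k ≤ L ∧ v = g k}) (g k) (g l) n := by
    intro k l hkl hl' e
    obtain ⟨n, hn, hpn⟩ := hB b1 h1 b2 h2 hne (e + k + (L - l))
    have h3 := (gw 0 k (by omega) (by omega)).symm.join (g0 ▸ ha1) hpn (by
        rintro v ⟨l, _, _, rfl⟩; exact gB l)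
    have h4 := h3.join (gL ▸ ha2.symm) (gw l L hl' le_rfl).symm (by
      rintro v (⟨a, _, _, rfl⟩ | hv) ⟨b, _, _, hb⟩
      · exact hinj a b (by omega) (by omega) hb
      · exact gB b (hb ▸ hv))
    refine ⟨_, ?_, h4.mono ?_⟩
    · omega
    · rintro v ((⟨l, _, _, rfl⟩ | hv) | ⟨l, _, _, rfl⟩)
      · exact Or.inr ⟨l, by omega, rfl⟩
      · exact Or.inl hv
      · exact Or.inr ⟨l, by omega, rfl⟩
  refine ⟨B ∪ {v | ∃ k, k ≤ L ∧ v = g k}, ?_, Set.subset_union_left,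
    Or.inr ⟨0, by omega, g0.symm⟩, ?_⟩
  · rintro x (hx | ⟨k, hk, rfl⟩) y (hy | ⟨l, hl, rfl⟩) hxy e
    · obtain ⟨n, hn, hpn⟩ := hB x hx y hy hxy e
      exact ⟨n, hn, hpn.mono Set.subset_union_left⟩
    · obtain ⟨n, hn, hpn⟩ := toB l hl x hx e
      exact ⟨n, hn, hpn.symm⟩
    · exact toB k hk y hy e
    · rcases lt_trichotomy k l with h | h | h
      · exact ear2 k l h hl e
      · exact absurd (by rw [h]) hxy
      · obtain ⟨n, hn, hpn⟩ := ear2 l k h hk e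
        exact ⟨n, hn, hpn.symm⟩
  · rintro v (hv | ⟨k, _, rfl⟩)
    · exact Or.inl hv
    · exact Or.inr (gS k)

lemma Rich.union {B B' : Set V} (hB : Rich G B) (hB' : Rich G B') {v : V} (hv : v ∈ B)
    (hv' : v ∈ B') : Rich G (B ∪ B') := by
  have key : ∀ x ∈ B, x ∉ B' → ∀ y ∈ B', y ∉ B → ∀ e : ℕ, ∃ n, n % 2 = e % 2 ∧
      PIn G (B ∪ B') x y n := by
    intro x hx hx' y hy hy' e
    obtain ⟨_, _, hp⟩ := hB' y hy v hv' (fun h => hy' (h ▸ hv)) 0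
    obtain ⟨a, b, hw, hab, hb, hb'⟩ := hp.toWIn.first hv hy'
    obtain ⟨m, hm⟩ := hw.exists_PIn
    obtain ⟨n, hn, hpn⟩ := hB b hb x hx (fun h => hx' (h ▸ hb')) (e + m + 1)
    refine ⟨m + n + 1, by omega, ((hm.join hab hpn ?_).mono ?_).symm⟩
    · intro w hw; exact hw.2
    · rintro w (hw | hw)
      · exact Or.inr hw.1
      · exact Or.inl hw
  rintro x hx y hy hxy e
  by_cases h1 : x ∈ B ∧ y ∈ B
  · obtain ⟨n, hn, hpn⟩ := hB x h1.1 y h1.2 hxy e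
    exact ⟨n, hn, hpn.mono Set.subset_union_left⟩
  by_cases h2 : x ∈ B' ∧ y ∈ B'
  · obtain ⟨n, hn, hpn⟩ := hB' x h2.1 y h2.2 hxy e
    exact ⟨n, hn, hpn.mono Set.subset_union_right⟩
  by_cases h3 : x ∈ B
  · have hy2 : y ∉ B := fun h => h1 ⟨h3, h⟩
    have hy3 : y ∈ B' := hy.resolve_left hy2
    exact key x h3 (fun h => h2 ⟨h, hy3⟩) y hy3 hy2 e
  · have hx3 : x ∈ B' := hx.resolve_left h3
    have hy2 : y ∉ B' := fun h => h2 ⟨hx3, h⟩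
    obtain ⟨n, hn, hpn⟩ := key y (hy.resolve_right hy2) hy2 x hx3 h3 e
    exact ⟨n, hn, hpn.symm⟩

/-- A retraction of `H` to a maximal rich set `B`. -/
structure Retr (G : SimpleGraph V) (H B : Set V) (π : V → V) : Prop where
  sub : B ⊆ H
  rich : Rich G B
  max : ∀ B', B' ⊆ H → Rich G B' → B ⊆ B' → B' ⊆ B
  mem : ∀ h ∈ H, π h ∈ B
  fix : ∀ b ∈ B, π b = b
  adj : ∀ h ∈ H, ∀ h' ∈ H, G.Adj h h' → π h = π h' ∨ (h ∈ B ∧ h' ∈ B)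
  fiber : ∀ h ∈ H, WIn G {v | v ∈ H ∧ π v = π h} h (π h)

lemma exists_retr [Finite V] {H D : Set V} (hH : ∀ x ∈ H, ∀ y ∈ H, WIn G H x y) (hD : D ⊆ H)
    (hR : Rich G D) (hne : D.Nonempty) : ∃ B π, D ⊆ B ∧ Retr G H B π := by
  classical
  obtain ⟨B, hDB, hmax⟩ := Finite.exists_le_maximal (p := fun B : Set V => B ⊆ H ∧ Rich G B)
    (a := D) ⟨hD, hR⟩
  have hsub : B ⊆ H := hmax.prop.1
  have hrich : Rich G B := hmax.prop.2
  have hmax' : ∀ B', B' ⊆ H → Rich G B' → B ⊆ B' → B' ⊆ B :=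
    fun B' h1 h2 h3 => hmax.le_of_ge ⟨h1, h2⟩ h3
  obtain ⟨d, hd⟩ := hne
  have hdB : d ∈ B := hDB hd
  -- the gate relation
  let gt : V → V → Prop := fun h b => b ∈ B ∧ (h = b ∨ ∃ x, WIn G (H \ B) h x ∧ G.Adj x b)
  have gtex : ∀ h ∈ H, ∃ b, gt h b := by
    intro h hh
    by_cases hB : h ∈ B
    · exact ⟨h, hB, Or.inl rfl⟩
    · obtain ⟨a, b, hw, hab, hb, _⟩ := (hH h hh d (hsub hdB)).first hdB hB
      exact ⟨b, hb, Or.inr ⟨a, hw, hab⟩⟩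
  have gtB : ∀ h ∈ B, ∀ b, gt h b → h = b := by
    rintro h hh b ⟨_, h1 | ⟨x, hw, _⟩⟩
    · exact h1
    · exact absurd hh hw.left_mem.2
  have gtuniq : ∀ h b1 b2, gt h b1 → gt h b2 → b1 = b2 := by
    intro h b1 b2 hg1 hg2
    by_cases hB : h ∈ B
    · rw [← gtB h hB b1 hg1, ← gtB h hB b2 hg2]
    by_contra hne
    obtain ⟨hb1, h1 | ⟨x1, hw1, ha1⟩⟩ := hg1
    · exact hB (h1 ▸ hb1)
    obtain ⟨hb2, h2 | ⟨x2, hw2, ha2⟩⟩ := hg2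
    · exact hB (h2 ▸ hb2)
    obtain ⟨n, hn⟩ := (hw1.symm.trans hw2).exists_PIn
    obtain ⟨B', hr, hBB', hx, hs⟩ := hrich.ear hb1 hb2 hne hn (fun v hv => hv.2) ha1 ha2
    exact hw1.right_mem.2 (hmax' B' (fun v hv => (hs hv).elim (fun h => hsub h) (fun h => h.1))
      hr hBB' hx)
  let π : V → V := fun h => if hh : h ∈ H then (gtex h hh).choose else h
  have hπ : ∀ h ∈ H, gt h (π h) := by
    intro h hh
    simp only [π, dif_pos hh]
    exact (gtex h hh).choose_spec
  have hfix : ∀ b ∈ B, π b = b := fun b hb => (gtB b hb _ (hπ b (hsub hb))).symm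
  have hadj1 : ∀ h ∈ H, ∀ h' ∈ H, G.Adj h h' → h ∉ B → π h = π h' := by
    intro h hh h' hh' ha hB
    refine gtuniq h _ _ (hπ h hh) ?_
    have := hπ h' hh'
    refine ⟨this.1, Or.inr ?_⟩
    rcases this.2 with h1 | ⟨x, hw, hx⟩
    · exact ⟨h, .refl ⟨hh, hB⟩, h1 ▸ ha⟩
    · exact ⟨x, .step ⟨hh, hB⟩ ha hw, hx⟩
  refine ⟨B, π, hDB, hsub, hrich, hmax', fun h hh => (hπ h hh).1, hfix, ?_, ?_⟩
  · intro h hh h' hh' ha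
    by_cases hB : h ∈ B
    · by_cases hB' : h' ∈ B
      · exact Or.inr ⟨hB, hB'⟩
      · exact Or.inl (hadj1 h' hh' h hh ha.symm hB').symm
    · exact Or.inl (hadj1 h hh h' hh' ha hB)
  · intro h hh
    rcases (hπ h hh).2 with h1 | ⟨x, hw, hx⟩
    · rw [← h1]
      refine .refl ⟨hh, ?_⟩
      rw [← h1]
    · have hb := (hπ h hh).1
      have key : ∀ {a b : V}, WIn G (H \ B) a b → G.Adj b (π h) →
          WIn G {v | v ∈ H ∧ π v = π h} a (π h) := by
        intro a b hab
        induction hab with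
        | @refl x' h' =>
          intro hadj
          refine .step ⟨h'.1, ?_⟩ hadj (.refl ⟨hsub hb, hfix _ hb⟩)
          exact gtuniq x' _ _ (hπ x' h'.1) ⟨hb, Or.inr ⟨x', .refl h', hadj⟩⟩
        | @step x' y' z' h1 h2 h3 ih =>
          intro hadj
          refine .step ⟨h1.1, ?_⟩ h2 (ih hadj)
          exact gtuniq x' _ _ (hπ x' h1.1) ⟨hb, Or.inr ⟨z', .step h1 h2 h3, hadj⟩⟩
      exact key hw hx

/-- Distinct fibers are linked by paths of both parities. -/
lemma Retr.link {H B : Set V} {π : V → V} (hr : Retr G H B π) {h h' : V} (hh : h ∈ H)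
    (hh' : h' ∈ H) (hne : π h ≠ π h') (e : ℕ) : ∃ n, n % 2 = e % 2 ∧ PIn G H h h' n := by
  obtain ⟨n1, h1⟩ := (hr.fiber h hh).exists_PIn
  obtain ⟨n2, h2⟩ := (hr.fiber h' hh').exists_PIn
  obtain ⟨n, hn, hp⟩ := hr.rich _ (hr.mem h hh) _ (hr.mem h' hh') hne (e + n1 + n2)
  have h3 := h1.append hp (by
    rintro v ⟨_, hv⟩ hvB
    rw [← hv, hr.fix v hvB])
  have h4 := h3.append h2.symm (by
    rintro v (⟨_, hv⟩ | hvB) ⟨_, hv'⟩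
    · exact absurd (hv.symm.trans hv') hne
    · rw [← hv', hr.fix v hvB])
  refine ⟨_, ?_, h4.mono ?_⟩
  · omega
  · rintro v ((hv | hv) | hv)
    · exact hv.1
    · exact hr.sub hv
    · exact hv.1

lemma Retr.fiber_conn {H B : Set V} {π : V → V} (hr : Retr G H B π) {h h' : V} (hh : h ∈ H)
    (hh' : h' ∈ H) (heq : π h = π h') : WIn G {v | v ∈ H ∧ π v = π h} h h' := by
  have h1 := hr.fiber h hh
  have h2 := hr.fiber h' hh'
  rw [← heq] at h2
  exact h1.trans h2.symm

/-- Two maximal rich sets are equal or disjoint. -/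
lemma Retr.disj {H B B' : Set V} {π π' : V → V} (hr : Retr G H B π) (hr' : Retr G H B' π')
    (hne : ¬ B' ⊆ B) : ∀ v ∈ B, v ∉ B' := by
  intro v hv hv'
  exact hne fun w hw => hr.max (B ∪ B') (Set.union_subset hr.sub hr'.sub)
    (hr.rich.union hr'.rich hv hv') Set.subset_union_left (Or.inr hw)

/-- `π` is constant along walks whose vertices avoid `B`. -/
lemma Retr.const {H B S : Set V} {π : V → V} (hr : Retr G H B π) (hS : S ⊆ H)
    (hSB : ∀ v ∈ S, v ∉ B) {x y : V} (h : WIn G S x y) : π x = π y := by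
  induction h with
  | refl h => rfl
  | step h1 h2 h3 ih =>
    rcases hr.adj _ (hS h1) _ (hS h3.left_mem) h2 with h | h
    · exact h.trans ih
    · exact absurd h.1 (hSB _ h1)

lemma pair_le (a b : V) : ({a, b} : Set V).ncard ≤ 2 := by
  have := Set.ncard_insert_le a {b}
  rw [Set.ncard_singleton] at this
  exact this

lemma conn3 (h3 : KConnected 3 G) (Z S : Set V) (hZ : Z.Nonempty) (hd : ∀ v ∈ Z, v ∉ S)
    (hS : S.ncard ≤ 2) (hy : ∃ y, y ∉ Z ∧ y ∉ S) :
    ∃ a ∈ Z, ∃ b, b ∉ Z ∧ b ∉ S ∧ G.Adj a b := by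
  obtain ⟨a, ha⟩ := hZ
  obtain ⟨y, hy1, hy2⟩ := hy
  have hc := h3.2 S (by omega)
  obtain ⟨w⟩ := hc.preconnected ⟨a, hd a ha⟩ ⟨y, hy2⟩
  obtain ⟨d, _, hd1, hd2⟩ := w.exists_boundary_dart {v | v.1 ∈ Z} ha hy1
  exact ⟨d.fst.1, hd1, d.snd.1, hd2, d.snd.2, d.adj⟩

/-- `C` is the vertex set of an even cycle. -/
def EvenCyc (G : SimpleGraph V) (C : Set V) : Prop :=
  ∃ s c, Cyc G (2 * s) c ∧ C = Set.range c

/-- The component of `z` after deleting `C`. -/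
def HH (G : SimpleGraph V) (z : V) (C : Set V) : Set V := {v | WIn G Cᶜ z v}

lemma EvenCyc.of_walk {u : V} (w : G.Walk u u) (hw : w.IsCycle) (he : w.length % 2 = 0) :
    EvenCyc G {v | v ∈ w.support} := by
  obtain ⟨h1, h2⟩ := Cyc.of_walk w hw
  refine ⟨w.length / 2, fun i => w.getVert (i % w.length), ?_, ?_⟩
  · rwa [show 2 * (w.length / 2) = w.length by omega]
  · ext v
    rw [Set.mem_ofPred_eq, h2 v]
    simp only [Set.mem_range, eq_comm]

/-- An even cycle avoiding `D` with `HH` as large as possible. -/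
structure Opt (G : SimpleGraph V) (D : Set V) (z : V) (C : Set V) : Prop where
  ev : EvenCyc G C
  disj : ∀ v ∈ D, v ∉ C
  max : ∀ C', EvenCyc G C' → (∀ v ∈ D, v ∉ C') → (HH G z C').ncard ≤ (HH G z C).ncard
  hz : z ∈ D
  hD : ∀ v ∈ D, WIn G D z v

section opt

variable {D C : Set V} {z : V}

lemma Opt.sub (ho : Opt G D z C) : D ⊆ HH G z C := fun v hv =>
  (ho.hD v hv).mono fun w hw => ho.disj w hw

lemma Opt.zmem (ho : Opt G D z C) : z ∈ HH G z C := ho.sub ho.hz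

lemma HH_disj {v : V} (hv : v ∈ HH G z C) : v ∉ C := WIn.right_mem hv

lemma HH_adj {v w : V} (hv : v ∈ HH G z C) (ha : G.Adj v w) (hw : w ∉ C) : w ∈ HH G z C :=
  WIn.trans hv (.step (HH_disj hv) ha (.refl hw))

lemma HH_conn {x y : V} (hx : x ∈ HH G z C) (hy : y ∈ HH G z C) : WIn G (HH G z C) x y :=
  (WIn.self hx).symm.trans (WIn.self hy)

lemma Opt.mono (ho : Opt G D z C) {C' : Set V} (hd : ∀ v ∈ HH G z C, v ∉ C') :
    HH G z C ⊆ HH G z C' := fun v hv =>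
  (HH_conn ho.zmem hv).mono fun w hw => hd w hw

lemma Opt.mem [Finite V] (ho : Opt G D z C) {C' : Set V} (he : EvenCyc G C')
    (hd : ∀ v ∈ HH G z C, v ∉ C') {t h : V} (ht : t ∈ C) (hh : h ∈ HH G z C) (ha : G.Adj h t) :
    t ∈ C' := by
  by_contra htC
  have h1 := ho.mono hd
  have h2 : t ∈ HH G z C' := HH_adj (h1 hh) ha htC
  have h3 : (HH G z C).ncard < (HH G z C').ncard :=
    Set.ncard_lt_ncard ⟨h1, fun h => HH_disj (h h2) ht⟩ (Set.toFinite _)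
  have := ho.max C' he (fun v hv => hd v (ho.sub hv))
  omega

lemma Opt.ear [Finite V] (h3 : KConnected 3 G) (ho : Opt G D z C) {s : ℕ} {c : ℕ → V}
    (hc : Cyc G (2 * s) c) (hC : C = Set.range c) {F : Set V} (hFC : ∀ v ∈ F, v ∉ C)
    (hFH : ∀ v ∈ F, v ∉ HH G z C) {f1 f2 : V} {l i j : ℕ} (hp : PIn G F f1 f2 l)
    (hij : i < j) (hj : j < 2 * s) (h1 : G.Adj f1 (c i)) (h2 : G.Adj f2 (c j))
    (hpar : (l + i + j) % 2 = 0) : False := by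
  have hcC : ∀ k, c k ∈ C := fun k => hC ▸ ⟨k, rfl⟩
  have hcF : ∀ k, c k ∉ F := fun k hk => hFC _ hk (hcC k)
  have hcH : ∀ k, c k ∉ HH G z C := fun k hk => HH_disj hk (hcC k)
  have hne : c i ≠ c j := hc.inj i j hij (by omega)
  have hs := hc.three
  have hP : PIn G (insert (c i) (F ∪ {c j})) (c i) (c j) (l + 0 + 1 + 1) := by
    refine PIn.cons h1.symm (hp.join (S' := {c j}) h2 (PIn.refl (Set.mem_singleton _)) ?_) ?_
    · intro v hv hv'
      rw [Set.mem_singleton_iff] at hv'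
      exact hcF j (hv' ▸ hv)
    · rintro (h | h)
      · exact hcF i h
      · exact hne h
  -- the attachments are among the two ends
  have hT : ∀ t h, t ∈ C → h ∈ HH G z C → G.Adj h t → t = c i ∨ t = c j := by
    intro t h ht hh ha
    rw [hC] at ht
    obtain ⟨k0, rfl⟩ := ht
    obtain ⟨k, hk1, hk2, hk⟩ := hc.window i k0
    rw [← hk] at ha ⊢
    by_cases hki : k = i
    · exact Or.inl (by rw [hki])
    by_cases hkj : k = j
    · exact Or.inr (by rw [hkj])
    exfalso
    by_cases hlt : k < j
    · have harc := hc.arc j (2 * s - (j - i)) (by omega)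
      rw [show j + (2 * s - (j - i)) = i + 2 * s by omega, hc.per] at harc
      obtain ⟨w, hw, hwl, hwS⟩ := hP.cycle harc.symm (by
        rintro v (hv | hv | hv) ⟨a, ha1, ha2, rfl⟩
        · exact Or.inl hv
        · exact absurd hv (hcF a)
        · exact Or.inr hv) (Or.inl (by omega))
      have hdis : ∀ v ∈ HH G z C, v ∉ {v | v ∈ w.support} := by
        intro v hv hvw
        rcases hwS v hvw with (hv' | hv' | hv') | ⟨a, _, _, rfl⟩
        · exact hcH i (hv' ▸ hv)
        · exact hFH v hv' hv
        · exact hcH j ((Set.mem_singleton_iff.1 hv') ▸ hv)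
        · exact hcH a hv
      have hin := ho.mem (EvenCyc.of_walk w hw (by omega)) hdis (hcC k) hh ha
      rcases hwS _ hin with (hv' | hv' | hv') | ⟨a, ha1, ha2, hv'⟩
      · exact hc.inj i k (by omega) (by omega) hv'.symm
      · exact hcF k hv'
      · exact hc.inj k j (by omega) (by omega) hv'
      · exact hc.inj k a (by omega) (by omega) hv'
    · have harc := hc.arc i (j - i) (by omega)
      rw [show i + (j - i) = j by omega] at harc
      obtain ⟨w, hw, hwl, hwS⟩ := hP.cycle harc (by
        rintro v (hv | hv | hv) ⟨a, ha1, ha2, rfl⟩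
        · exact Or.inl hv
        · exact absurd hv (hcF a)
        · exact Or.inr hv) (Or.inl (by omega))
      have hdis : ∀ v ∈ HH G z C, v ∉ {v | v ∈ w.support} := by
        intro v hv hvw
        rcases hwS v hvw with (hv' | hv' | hv') | ⟨a, _, _, rfl⟩
        · exact hcH i (hv' ▸ hv)
        · exact hFH v hv' hv
        · exact hcH j ((Set.mem_singleton_iff.1 hv') ▸ hv)
        · exact hcH a hv
      have hin := ho.mem (EvenCyc.of_walk w hw (by omega)) hdis (hcC k) hh ha
      rcases hwS _ hin with (hv' | hv' | hv') | ⟨a, ha1, ha2, hv'⟩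
      · exact hc.inj i k (by omega) (by omega) hv'.symm
      · exact hcF k hv'
      · exact hc.inj j k (by omega) (by omega) hv'.symm
      · exact hc.inj a k (by omega) (by omega) hv'.symm
  obtain ⟨a, ha, b, hb1, hb2, hab⟩ := conn3 h3 (HH G z C) {c i, c j} ⟨z, ho.zmem⟩ (by
    rintro v hv (rfl | hv')
    · exact hcH i hv
    · exact hcH j ((Set.mem_singleton_iff.1 hv') ▸ hv)) (Set.ncard_pair hne).le (by
    by_cases h : j = i + 1
    · refine ⟨c (i + 2), hcH _, ?_⟩
      rintro (h' | h')
      · exact hc.inj i (i + 2) (by omega) (by omega) h'.symm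
      · exact hc.inj j (i + 2) (by omega) (by omega) h'.symm
    · refine ⟨c (i + 1), hcH _, ?_⟩
      rintro (h' | h')
      · exact hc.inj i (i + 1) (by omega) (by omega) h'.symm
      · exact hc.inj (i + 1) j (by omega) (by omega) h')
  have hbC : b ∈ C := by
    by_contra h
    exact hb1 (HH_adj ha hab h)
  rcases hT b a hbC ha hab with h | h
  · exact hb2 (Or.inl h)
  · exact hb2 (Or.inr h)

lemma spider {F : Set V} {f1 f2 f3 : V} (h12 : WIn G F f1 f2) (h13 : WIn G F f1 f3) :
    ∃ l1 l2 l3, PIn G F f1 f2 (l1 + l2) ∧ PIn G F f1 f3 (l1 + l3) ∧ PIn G F f2 f3 (l2 + l3) := by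
  classical
  obtain ⟨n, p, hp, hl, hS⟩ := h12.exists_PIn
  have key : ∀ x ∈ p.support, ∃ l1 l2, l1 + l2 = n ∧ PIn G {v | v ∈ p.support} f1 x l1 ∧
      PIn G {v | v ∈ p.support} f2 x l2 := by
    intro x hx
    refine ⟨(p.takeUntil x hx).length, (p.dropUntil x hx).length, ?_, ?_, ?_⟩
    · rw [← hl, ← SimpleGraph.Walk.length_append, SimpleGraph.Walk.take_spec]
    · exact ⟨_, hp.takeUntil hx, rfl, fun v hv => p.support_takeUntil_subset_support hx hv⟩
    · refine PIn.symm ⟨_, hp.dropUntil hx, rfl, fun v hv => p.support_dropUntil_subset_support hx hv⟩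
  by_cases h3 : f3 ∈ p.support
  · obtain ⟨l1, l2, h, ha, hb⟩ := key f3 h3
    exact ⟨l1, l2, 0, h ▸ ⟨p, hp, hl, hS⟩, ha.mono hS, hb.mono hS⟩
  · obtain ⟨a, b, hw, hab, hb, _⟩ := WIn.first (B := {v | v ∈ p.support}) h13.symm
      p.start_mem_support h3
    obtain ⟨m, hm⟩ := hw.exists_PIn
    obtain ⟨l1, l2, h, h1, h2⟩ := key b hb
    refine ⟨l1, l2, m + 1, h ▸ ⟨p, hp, hl, hS⟩, ?_, ?_⟩
    · have := (hm.join hab h1.symm (fun v hv => hv.2)).symm.mono (S' := F) (by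
        rintro v (hv | hv)
        · exact hv.1
        · exact hS v hv)
      rwa [show m + l1 + 1 = l1 + (m + 1) by omega] at this
    · have := (hm.join hab h2.symm (fun v hv => hv.2)).symm.mono (S' := F) (by
        rintro v (hv | hv)
        · exact hv.1
        · exact hS v hv)
      rwa [show m + l2 + 1 = l2 + (m + 1) by omega] at this

lemma Opt.noFree [Finite V] (h3 : KConnected 3 G) (ho : Opt G D z C) (f : V) :
    f ∈ C ∨ f ∈ HH G z C := by
  by_contra hcon
  push Not at hcon
  obtain ⟨hfC, hfH⟩ := hcon
  obtain ⟨s, c, hc, hC⟩ := ho.ev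
  set F : Set V := {v | WIn G Cᶜ f v} with hF
  have hFC : ∀ v ∈ F, v ∉ C := fun v hv => WIn.right_mem hv
  have hFH : ∀ v ∈ F, v ∉ HH G z C := fun v hv hv' => hfH (WIn.trans hv' (WIn.symm hv))
  have hfF : f ∈ F := .refl hfC
  have hFF : ∀ x ∈ F, ∀ y ∈ F, WIn G F x y := fun x hx y hy =>
    (WIn.self hx).symm.trans (WIn.self hy)
  have hzF : z ∉ F := fun h => hFH z h ho.zmem
  have hzC : z ∉ C := HH_disj ho.zmem
  have hnb : ∀ S : Set V, S ⊆ C → S.ncard ≤ 2 →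
      ∃ a ∈ F, ∃ i, i < 2 * s ∧ c i ∉ S ∧ G.Adj a (c i) := by
    intro S hS hcard
    obtain ⟨a, ha, b, hb1, hb2, hab⟩ := conn3 h3 F S ⟨f, hfF⟩ (fun v hv hv' => hFC v hv (hS hv'))
      hcard ⟨z, hzF, fun h => hzC (hS h)⟩
    have hbC : b ∈ C := by
      by_contra h
      exact hb1 (WIn.trans ha (.step (hFC a ha) hab (.refl h)))
    rw [hC] at hbC
    obtain ⟨i0, rfl⟩ := hbC
    obtain ⟨i, _, hi, hii⟩ := hc.window 0 i0
    exact ⟨a, ha, i, by omega, hii ▸ hb2, hii ▸ hab⟩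
  have hcC : ∀ k, c k ∈ C := fun k => hC ▸ ⟨k, rfl⟩
  obtain ⟨f1, hf1, i1, hi1, _, ha1⟩ := hnb ∅ (by simp) (by simp)
  obtain ⟨f2, hf2, i2, hi2, hn2, ha2⟩ := hnb {c i1} (by simp [hcC]) (by simp)
  obtain ⟨f3, hf3, i3, hi3, hn3, ha3⟩ := hnb {c i1, c i2}
    (by rintro v (rfl | rfl) <;> exact hcC _) (pair_le _ _)
  have h12 : i1 ≠ i2 := by rintro rfl; exact hn2 rfl
  have h13 : i1 ≠ i3 := by rintro rfl; exact hn3 (Or.inl rfl)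
  have h23 : i2 ≠ i3 := by rintro rfl; exact hn3 (Or.inr rfl)
  obtain ⟨l1, l2, l3, hp12, hp13, hp23⟩ := spider (hFF f1 hf1 f2 hf2) (hFF f1 hf1 f3 hf3)
  have fin : ∀ (g1 g2 : V) (i j l : ℕ), PIn G F g1 g2 l → i ≠ j → i < 2 * s → j < 2 * s →
      G.Adj g1 (c i) → G.Adj g2 (c j) → (l + i + j) % 2 = 0 → False := by
    intro g1 g2 i j l hp hij hi hj hg1 hg2 hpar
    rcases lt_or_gt_of_ne hij with h | h
    · exact ho.ear h3 hc hC hFC hFH hp h hj hg1 hg2 hpar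
    · exact ho.ear h3 hc hC hFC hFH hp.symm h hi hg2 hg1 (by omega)
  by_cases e1 : (l1 + l2 + i1 + i2) % 2 = 0
  · exact fin f1 f2 i1 i2 _ hp12 h12 hi1 hi2 ha1 ha2 e1
  by_cases e2 : (l1 + l3 + i1 + i3) % 2 = 0
  · exact fin f1 f3 i1 i3 _ hp13 h13 hi1 hi3 ha1 ha3 e2
  · exact fin f2 f3 i2 i3 _ hp23 h23 hi2 hi3 ha2 ha3 (by omega)

lemma Opt.hamil [Finite V] (h3 : KConnected 3 G) (ho : Opt G D z C) {C' : Set V}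
    (he : EvenCyc G C') (hsub : C' ⊆ C) : C ⊆ C' := by
  have hd : ∀ v ∈ HH G z C, v ∉ C' := fun v hv hv' => HH_disj hv (hsub hv')
  have h1 := ho.mono hd
  have hdD : ∀ v ∈ D, v ∉ C' := fun v hv => hd v (ho.sub hv)
  have h2 := ho.max C' he hdD
  have h4 : HH G z C = HH G z C' := Set.eq_of_subset_of_ncard_le h1 h2 (Set.toFinite _)
  have ho' : Opt G D z C' := ⟨he, hdD, fun C'' h5 h6 => h4 ▸ ho.max C'' h5 h6, ho.hz, ho.hD⟩
  intro v hv
  rcases ho'.noFree h3 v with h | h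
  · exact h
  · rw [← h4] at h
    exact absurd hv (HH_disj h)

lemma Opt.two_arcs [Finite V] (h3 : KConnected 3 G) (ho : Opt G D z C) {s : ℕ} {c : ℕ → V}
    (hc : Cyc G (2 * s) c) (hC : C = Set.range c) {p q r t : ℕ} (hpq : p ≤ q) (hqr : q < r)
    (hrt : r ≤ t) (htp : t < p + 2 * s)
    (hadj : (G.Adj (c q) (c r) ∧ G.Adj (c t) (c p)) ∨ (G.Adj (c q) (c t) ∧ G.Adj (c r) (c p)))
    (hpar : ((q - p) + (t - r)) % 2 = 0) (hpos : 0 < (q - p) + (t - r)) :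
    ∀ j, p ≤ j → j < p + 2 * s → j ≤ q ∨ (r ≤ j ∧ j ≤ t) := by
  have h1 := hc.arc p (q - p) (by omega)
  have h2 := hc.arc r (t - r) (by omega)
  rw [show p + (q - p) = q by omega] at h1
  rw [show r + (t - r) = t by omega] at h2
  have hdisj : ∀ v ∈ {v | ∃ j, p ≤ j ∧ j ≤ q ∧ v = c j}, v ∉ {v | ∃ j, r ≤ j ∧ j ≤ t ∧ v = c j} := by
    rintro v ⟨a, ha1, ha2, rfl⟩ ⟨b, hb1, hb2, hb⟩
    exact hc.inj a b (by omega) (by omega) hb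
  have hw : ∃ w : G.Walk (c p) (c p), w.IsCycle ∧ w.length % 2 = 0 ∧ ∀ v ∈ w.support,
      v ∈ {v | ∃ j, p ≤ j ∧ j ≤ q ∧ v = c j} ∪ {v | ∃ j, r ≤ j ∧ j ≤ t ∧ v = c j} := by
    rcases hadj with ⟨ha, hb⟩ | ⟨ha, hb⟩
    · obtain ⟨w, hw, hl, hS⟩ := (h1.join ha h2 hdisj).close hb (by omega)
      exact ⟨w, hw, by omega, hS⟩
    · obtain ⟨w, hw, hl, hS⟩ := (h1.join ha h2.symm hdisj).close hb (by omega)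
      exact ⟨w, hw, by omega, hS⟩
  obtain ⟨w, hw, hl, hS⟩ := hw
  have hsub := ho.hamil h3 (EvenCyc.of_walk w hw hl) (by
    intro v hv
    rw [hC]
    rcases hS v hv with ⟨j, _, _, rfl⟩ | ⟨j, _, _, rfl⟩ <;> exact ⟨j, rfl⟩)
  intro j hj1 hj2
  have hjC : c j ∈ C := hC ▸ ⟨j, rfl⟩
  rcases hS _ (hsub hjC) with ⟨k, hk1, hk2, hk⟩ | ⟨k, hk1, hk2, hk⟩
  · rcases lt_trichotomy j k with h | h | h
    · exact absurd hk (hc.inj j k h (by omega))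
    · omega
    · exact absurd hk.symm (hc.inj k j h (by omega))
  · rcases lt_trichotomy j k with h | h | h
    · exact absurd hk (hc.inj j k h (by omega))
    · omega
    · exact absurd hk.symm (hc.inj k j h (by omega))

lemma Opt.two_chords [Finite V] (h3 : KConnected 3 G) (ho : Opt G D z C) {s : ℕ} {c : ℕ → V}
    (hc : Cyc G (2 * s) c) (hC : C = Set.range c) {e e' k l : ℕ} (he : e < e')
    (he' : e' < e + 2 * s) (hep : (e' - e) % 2 = 0) (hk : e ≤ k) (hkl : k < l)
    (hl : l < e + 2 * s) (hklp : (l - k) % 2 = 0) (hne : ¬ (k = e ∧ l = e'))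
    (ha : G.Adj (c e) (c e')) (hb : G.Adj (c k) (c l)) : 2 * s = 4 := by
  have hper : c (e + 2 * s) = c e := hc.per e
  have ha' : G.Adj (c e') (c (e + 2 * s)) := hper ▸ ha.symm
  by_cases hke : k = e
  · subst hke
    exfalso
    rcases lt_trichotomy l e' with h | h | h
    · have := ho.two_arcs h3 hc hC (p := k) (q := k) (r := l) (t := e') le_rfl hkl h.le (by omega)
        (Or.inl ⟨hb, ha.symm⟩) (by omega) (by omega) (k + 1) (by omega) (by omega)
      omega
    · exact hne ⟨rfl, h⟩
    · have := ho.two_arcs h3 hc hC (p := k) (q := k) (r := e') (t := l) le_rfl he h.le (by omega)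
        (Or.inl ⟨ha, hb.symm⟩) (by omega) (by omega) (k + 1) (by omega) (by omega)
      omega
  by_cases hle : l ≤ e'
  · exfalso
    have := ho.two_arcs h3 hc hC (p := e) (q := k) (r := l) (t := e') hk hkl hle (by omega)
        (Or.inl ⟨hb, ha.symm⟩) (by omega) (by omega) (k + 1) (by omega) (by omega)
    omega
  by_cases hke' : e' ≤ k
  · exfalso
    have := ho.two_arcs h3 hc hC (p := e') (q := k) (r := l) (t := e + 2 * s) hke' hkl (by omega)
        (by omega) (Or.inl ⟨hb, ha'.symm⟩) (by omega) (by omega) (k + 1) (by omega) (by omega)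
    omega
  · have h1 := ho.two_arcs h3 hc hC (p := e) (q := k) (r := e') (t := l) hk (by omega) (by omega)
        hl (Or.inr ⟨hb, ha.symm⟩) (by omega) (by omega)
    have h2 := ho.two_arcs h3 hc hC (p := k) (q := e') (r := l) (t := e + 2 * s) (by omega)
        (by omega) (by omega) (by omega) (Or.inr ⟨ha', hb.symm⟩) (by omega) (by omega)
    have h1a := h1 (k + 1) (by omega) (by omega)
    have h1b : l + 1 = e + 2 * s := by
      by_contra h
      have := h1 (l + 1) (by omega) (by omega)
      omega
    have h2a := h2 (e' + 1) (by omega) (by omega)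
    have h2b : k = e + 1 := by
      by_contra h
      have := h2 (e + 2 * s + 1) (by omega) (by omega)
      omega
    omega

lemma Opt.chord [Finite V] (h3 : KConnected 3 G) (ho : Opt G D z C) {s : ℕ} {c : ℕ → V}
    (hc : Cyc G (2 * s) c) (hC : C = Set.range c) {e : ℕ}
    (he : ∀ h ∈ HH G z C, ¬ G.Adj h (c e)) :
    ∃ e', e + 2 ≤ e' ∧ e' + 2 ≤ e + 2 * s ∧ (e' - e) % 2 = 0 ∧ G.Adj (c e) (c e') := by
  have hs := hc.three
  obtain ⟨a, ha, b, hb1, hb2, hab⟩ := conn3 h3 {c e} {c (e + 1), c (e + 2 * s - 1)} ⟨_, rfl⟩ (by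
    rintro v rfl (h | h)
    · exact hc.inj e (e + 1) (by omega) (by omega) h
    · exact hc.inj e (e + 2 * s - 1) (by omega) (by omega) h) (pair_le _ _) (by
    refine ⟨c (e + 2), fun h => hc.inj e (e + 2) (by omega) (by omega) h.symm, ?_⟩
    rintro (h | h)
    · exact hc.inj (e + 1) (e + 2) (by omega) (by omega) h.symm
    · exact hc.inj (e + 2) (e + 2 * s - 1) (by omega) (by omega) h)
  rw [Set.mem_singleton_iff] at ha
  subst ha
  have hbC : b ∈ C := (ho.noFree h3 b).resolve_right fun h => he b h hab.symm
  rw [hC] at hbC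
  obtain ⟨j, rfl⟩ := hbC
  obtain ⟨e', h1, h2, h4⟩ := hc.window e j
  rw [← h4] at hb1 hb2 hab
  have n0 : e' ≠ e := by rintro rfl; exact hb1 rfl
  have n1 : e' ≠ e + 1 := by rintro rfl; exact hb2 (Or.inl rfl)
  have n2 : e' ≠ e + 2 * s - 1 := by rintro rfl; exact hb2 (Or.inr rfl)
  refine ⟨e', by omega, by omega, ?_, hab⟩
  by_contra hodd
  have := ho.two_arcs h3 hc hC (p := e) (q := e) (r := e + 1) (t := e') le_rfl (by omega) (by omega)
    h2 (Or.inl ⟨hc.adj e, hab.symm⟩) (by omega) (by omega) (e + 2 * s - 1) (by omega) (by omega)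
  omega

/-- All vertices of the cycle but at most two of the same parity are attached. -/
lemma Opt.empties [Finite V] (h3 : KConnected 3 G) (ho : Opt G D z C) {s : ℕ} {c : ℕ → V}
    (hc : Cyc G (2 * s) c) (hC : C = Set.range c) :
    ∃ e e', e ≤ e' ∧ e' < e + 2 * s ∧ (e' - e) % 2 = 0 ∧
      ((∀ h ∈ HH G z C, ¬ G.Adj h (c e)) ∨ ∀ j, ∃ h ∈ HH G z C, G.Adj h (c j)) ∧
      ∀ j, (∀ h ∈ HH G z C, ¬ G.Adj h (c j)) → c j = c e ∨ c j = c e' := by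
  have hs := hc.three
  by_cases hex : ∃ e, ∀ h ∈ HH G z C, ¬ G.Adj h (c e)
  swap
  · push Not at hex
    refine ⟨0, 0, le_rfl, by omega, by simp, Or.inr hex, fun j hj => ?_⟩
    obtain ⟨h, hh, ha⟩ := hex j
    exact absurd ha (hj h hh)
  obtain ⟨e, he⟩ := hex
  obtain ⟨e', h1, h2, hp, ha⟩ := ho.chord h3 hc hC he
  refine ⟨e, e', by omega, by omega, hp, Or.inl he, ?_⟩
  intro j hj
  obtain ⟨f, hf1, hf2, hf⟩ := hc.window e j
  rw [← hf] at hj ⊢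
  by_contra hcon
  push Not at hcon
  have n1 : f ≠ e := fun h => hcon.1 (by rw [h])
  have n2 : f ≠ e' := fun h => hcon.2 (by rw [h])
  have h4 : 2 * s = 4 := by
    obtain ⟨f', g1, g2, gp, ga⟩ := ho.chord h3 hc hC hj
    by_cases hlt : f' < e + 2 * s
    · exact ho.two_chords h3 hc hC (k := f) (l := f') (by omega) (by omega) hp hf1 (by omega) hlt gp
        (by omega) ha ga
    · have hper := hc.per (f' - 2 * s)
      rw [show f' - 2 * s + 2 * s = f' by omega] at hper
      rw [hper] at ga
      exact ho.two_chords h3 hc hC (k := f' - 2 * s) (l := f) (by omega) (by omega) hp (by omega)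
        (by omega) hf2 (by omega) (by omega) ha ga.symm
  -- the four-cycle case
  obtain ⟨a, haH, b, hb1, hb2, hab⟩ := conn3 h3 (HH G z C) {c e', c (2 * e + 4 - f)} ⟨z, ho.zmem⟩ (by
    rintro v hv (rfl | hv')
    · exact HH_disj hv (hC ▸ ⟨_, rfl⟩)
    · rw [Set.mem_singleton_iff] at hv'
      exact HH_disj hv (hC ▸ ⟨_, hv'.symm⟩)) (pair_le _ _) (by
    refine ⟨c e, fun h => HH_disj h (hC ▸ ⟨_, rfl⟩), ?_⟩
    rintro (h | h)
    · exact hc.inj e e' (by omega) (by omega) h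
    · exact hc.inj e (2 * e + 4 - f) (by omega) (by omega) h)
  have hbC : b ∈ C := by
    by_contra h
    exact hb1 (HH_adj haH hab h)
  rw [hC] at hbC
  obtain ⟨j', rfl⟩ := hbC
  obtain ⟨g, hg1, hg2, hg⟩ := hc.window e j'
  rw [← hg] at hab hb2
  have m1 : g ≠ e := fun h => he a haH (h ▸ hab)
  have m2 : g ≠ f := fun h => hj a haH (h ▸ hab)
  have m3 : g ≠ e' := fun h => hb2 (Or.inl (by rw [h]))
  have m4 : g ≠ 2 * e + 4 - f := fun h => hb2 (Or.inr (by rw [h]; rfl))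
  omega

end opt

section final

variable {H B : Set V} {π : V → V} {s : ℕ} {c : ℕ → V}

lemma win (hc : Cyc G (2 * s) c) (hHc : ∀ j, c j ∉ H) {h h' : V} {l i : ℕ}
    (hp : PIn G H h h' l) (h1 : G.Adj h (c i)) (h2 : G.Adj h' (c (i + (s - 1))))
    (hl : (l + (s - 1)) % 2 = 0) : HasTwoConsecEvenCycles G := by
  have hs := hc.three
  have hne : c i ≠ c (i + (s - 1)) := hc.inj _ _ (by omega) (by omega)
  have hP : PIn G (insert (c i) (H ∪ {c (i + (s - 1))})) (c i) (c (i + (s - 1)))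
      (l + 0 + 1 + 1) := by
    refine PIn.cons h1.symm (hp.join (S' := {c (i + (s - 1))}) h2
      (PIn.refl (Set.mem_singleton _)) ?_) ?_
    · intro v hv hv'
      rw [Set.mem_singleton_iff] at hv'
      exact hHc _ (hv' ▸ hv)
    · rintro (h | h)
      · exact hHc i h
      · exact hne h
  have harc1 := hc.arc i (s - 1) (by omega)
  have harc2 := hc.arc (i + (s - 1)) (s + 1) (by omega)
  rw [show i + (s - 1) + (s + 1) = i + 2 * s by omega, hc.per] at harc2
  obtain ⟨w, hw, hwl, _⟩ := hP.cycle harc1 (by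
    rintro v (hv | hv | hv) ⟨a, ha1, ha2, rfl⟩
    · exact Or.inl hv
    · exact absurd hv (hHc a)
    · exact Or.inr hv) (Or.inl (by omega))
  obtain ⟨w', hw', hwl', _⟩ := hP.cycle harc2.symm (by
    rintro v (hv | hv | hv) ⟨a, ha1, ha2, rfl⟩
    · exact Or.inl hv
    · exact absurd hv (hHc a)
    · exact Or.inr hv) (Or.inl (by omega))
  exact ⟨_, _, w, w', (l + 2 + (s - 1)) / 2, hw, hw', by omega, by omega, by omega⟩

lemma att_step (hn : ¬ HasTwoConsecEvenCycles G) (hc : Cyc G (2 * s) c) (hHc : ∀ j, c j ∉ H)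
    (hr : Retr G H B π) {h h' : V} {j : ℕ} (hh : h ∈ H) (hh' : h' ∈ H) (h1 : G.Adj h (c j))
    (h2 : G.Adj h' (c (j + (s - 1)))) : π h = π h' := by
  by_contra hne
  obtain ⟨n, hn', hp⟩ := hr.link hh hh' hne (s - 1)
  exact hn (win hc hHc hp h1 h2 (by omega))

lemma noCut [Finite V] (h3 : KConnected 3 G) (hc : Cyc G (2 * s) c) (hHc : ∀ j, c j ∉ H)
    (hHa : ∀ h ∈ H, ∀ v, G.Adj h v → v ∈ H ∨ ∃ j, v = c j)
    (hr : Retr G H B π) (hB : 3 ≤ B.ncard) (w q : V)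
    (hcov : ∀ h ∈ H, ∀ j, G.Adj h (c j) → c j ≠ w → c j ≠ q → π h = w ∨ π h = q) : False := by
  have hs := hc.three
  have hS := pair_le w q
  obtain ⟨b, hb, hbS⟩ := Set.exists_mem_notMem_of_ncard_lt_ncard
    (s := {w, q}) (t := B) (by omega) (Set.toFinite _)
  have h01 := hc.inj 0 1 (by omega) (by omega)
  have h02 := hc.inj 0 2 (by omega) (by omega)
  have h12 := hc.inj 1 2 (by omega) (by omega)
  obtain ⟨j, hj⟩ : ∃ j, c j ∉ ({w, q} : Set V) := by
    by_contra hcon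
    push Not at hcon
    rcases hcon 0 with g0 | g0 <;> rcases hcon 1 with g1 | g1 <;> rcases hcon 2 with g2 | g2 <;>
      first
      | exact h01 (g0.trans g1.symm)
      | exact h02 (g0.trans g2.symm)
      | exact h12 (g1.trans g2.symm)
  obtain ⟨a, ⟨ha, ha1, haS⟩, v, hv1, hv2, hav⟩ := conn3 h3
    {h | h ∈ H ∧ π h ∉ ({w, q} : Set V) ∧ h ∉ ({w, q} : Set V)} {w, q}
    ⟨b, hr.sub hb, by rwa [hr.fix b hb], hbS⟩ (fun v hv => hv.2.2) hS
    ⟨c j, fun h => hHc j h.1, hj⟩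
  rcases hHa a ha v hav with hvH | ⟨i, rfl⟩
  · have hπ : π v ∈ ({w, q} : Set V) := by
      by_contra h
      exact hv1 ⟨hvH, h, hv2⟩
    rcases hr.adj a ha v hvH hav with h | ⟨_, h⟩
    · exact ha1 (h ▸ hπ)
    · rw [hr.fix v h] at hπ
      exact hv2 hπ
  · exact ha1 (hcov a ha i hav (fun h => hv2 (Or.inl h)) (fun h => hv2 (Or.inr h)))

lemma run {p : ℕ → V} {α β : ℕ}
    (hst : ∀ k, ∀ h ∈ H, ∀ h' ∈ H, G.Adj h (p k) → G.Adj h' (p (k + 1)) → π h = π h')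
    (hT : ∀ k, α ≤ k → k < β → ∃ h ∈ H, G.Adj h (p k)) (hab : β ≠ α + 1) :
    ∃ w, ∀ k, α ≤ k → k < β → ∀ h ∈ H, G.Adj h (p k) → π h = w := by
  by_cases hlt : α + 1 < β
  · obtain ⟨g, hg, hga⟩ := hT (α + 1) (by omega) hlt
    refine ⟨π g, fun k hk => ?_⟩
    induction k, hk using Nat.le_induction with
    | base => exact fun _ h hh ha => hst α h hh g hg ha hga
    | succ k hk ih =>
      intro hkb h hh ha
      obtain ⟨g', hg', hga'⟩ := hT k hk (by omega)
      rw [← hst k g' hg' h hh hga' ha]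
      exact ih (by omega) g' hg' hga'
  · exact ⟨p 0, fun k h1 h2 => by omega⟩

lemma runs (P : (V → V) → Prop) {p : ℕ → V} {N m : ℕ} (hN : 3 ≤ N) (hm : m < N)
    (hst : ∀ π, P π → ∀ k, ∀ h ∈ H, ∀ h' ∈ H, G.Adj h (p k) → G.Adj h' (p (k + 1)) → π h = π h')
    (h0 : ∀ h ∈ H, ¬ G.Adj h (p 0))
    (hT : ∀ k, 0 < k → k < N → k ≠ m → ∃ h ∈ H, G.Adj h (p k)) :
    ∃ X : Set V, ∀ π, P π → ∃ w q, (∀ x ∈ X, x = q ∨ (N = 4 ∧ x = w)) ∧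
      ∀ k < N, ∀ h ∈ H, G.Adj h (p k) → p k ∉ X → π h = w ∨ π h = q := by
  by_cases hmT : ∃ h ∈ H, G.Adj h (p m)
  · refine ⟨∅, fun π hπ => ?_⟩
    obtain ⟨w, hw⟩ := run (α := 1) (β := N) (hst π hπ) (fun k h1 h2 => by
      by_cases h : k = m
      · exact h ▸ hmT
      · exact hT k (by omega) h2 h) (by omega)
    refine ⟨w, w, by simp, fun k hk h hh ha _ => Or.inl ?_⟩
    by_cases hk0 : k = 0
    · exact absurd (hk0 ▸ ha) (h0 h hh)
    · exact hw k (by omega) hk h hh ha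
  push Not at hmT
  have trich : ∀ k < N, ∀ h ∈ H, G.Adj h (p k) → (1 ≤ k ∧ k < m) ∨ (m + 1 ≤ k ∧ k < N) := by
    intro k hk h hh ha
    have n0 : k ≠ 0 := fun e => h0 h hh (e ▸ ha)
    have nm : k ≠ m := fun e => hmT h hh (e ▸ ha)
    omega
  have T1 : ∀ k, 1 ≤ k → k < m → ∃ h ∈ H, G.Adj h (p k) :=
    fun k h1 h2 => hT k (by omega) (by omega) (by omega)
  have T2 : ∀ k, m + 1 ≤ k → k < N → ∃ h ∈ H, G.Adj h (p k) :=
    fun k h1 h2 => hT k (by omega) (by omega) (by omega)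
  by_cases hm2 : m = 2
  · by_cases hN4 : N = 4
    · refine ⟨{p 1, p 3}, fun π _ => ⟨p 3, p 1, ?_, ?_⟩⟩
      · rintro x (h | h)
        · exact Or.inl h
        · exact Or.inr ⟨hN4, h⟩
      · intro k hk h hh ha hX
        exfalso
        have := trich k hk h hh ha
        have hk : k = 1 ∨ k = 3 := by omega
        rcases hk with rfl | rfl
        · exact hX (Or.inl rfl)
        · exact hX (Or.inr rfl)
    · refine ⟨{p 1}, fun π hπ => ?_⟩
      obtain ⟨w, hw⟩ := run (α := m + 1) (β := N) (hst π hπ) T2 (by omega)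
      refine ⟨w, p 1, fun x hx => Or.inl hx, fun k hk h hh ha hX => Or.inl ?_⟩
      rcases trich k hk h hh ha with h1 | h1
      · exact absurd (by rw [show k = 1 by omega]; rfl) hX
      · exact hw k h1.1 h1.2 h hh ha
  by_cases hm3 : m + 2 = N
  · refine ⟨{p (m + 1)}, fun π hπ => ?_⟩
    obtain ⟨w, hw⟩ := run (α := 1) (β := m) (hst π hπ) T1 (by omega)
    refine ⟨w, p (m + 1), fun x hx => Or.inl hx, fun k hk h hh ha hX => Or.inl ?_⟩
    rcases trich k hk h hh ha with h1 | h1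
    · exact hw k h1.1 h1.2 h hh ha
    · exact absurd (by rw [show k = m + 1 by omega]; rfl) hX
  · refine ⟨∅, fun π hπ => ?_⟩
    obtain ⟨w, hw⟩ := run (α := 1) (β := m) (hst π hπ) T1 (by omega)
    obtain ⟨w', hw'⟩ := run (α := m + 1) (β := N) (hst π hπ) T2 (by omega)
    refine ⟨w, w', by simp, fun k hk h hh ha hX => ?_⟩
    rcases trich k hk h hh ha with h1 | h1
    · exact Or.inl (hw k h1.1 h1.2 h hh ha)
    · exact Or.inr (hw' k h1.1 h1.2 h hh ha)

lemma Cyc.mod_eq {n : ℕ} (hc : Cyc G n c) {a b : ℕ} (h : c a = c b) : (n : ℤ) ∣ (a : ℤ) - b := by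
  have hn := hc.three
  have h1 : c (a % n) = c (b % n) := by
    have ha := per_mul hc.per (a % n) (a / n)
    have hb := per_mul hc.per (b % n) (b / n)
    rw [Nat.mod_add_div] at ha hb
    rw [← ha, ← hb, h]
  have la := Nat.mod_lt a (show 0 < n by omega)
  have lb := Nat.mod_lt b (show 0 < n by omega)
  have h2 : a % n = b % n := by
    rcases lt_trichotomy (a % n) (b % n) with h | h | h
    · exact absurd h1 (hc.inj _ _ h (by omega))
    · exact h
    · exact absurd h1.symm (hc.inj _ _ h (by omega))
  exact (Nat.modEq_iff_dvd.1 (show b ≡ a [MOD n] from h2.symm))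

/-- Parametrisation of the cycle by steps of length `s - 1`, for `s` even. -/
lemma param_even (hc : Cyc G (2 * s) c) (hs : s % 2 = 0) (e : ℕ) :
    (∀ k l, k < 2 * s → l < 2 * s → c (e + k * (s - 1)) = c (e + l * (s - 1)) → k = l) ∧
    (∀ j, ∃ k < 2 * s, c j = c (e + k * (s - 1))) := by
  have h3 := hc.three
  obtain ⟨r, rfl⟩ : ∃ r, s = 2 * r + 2 := ⟨s / 2 - 1, by omega⟩
  rw [show 2 * r + 2 - 1 = 2 * r + 1 by omega]
  constructor
  · intro k l hk hl h
    obtain ⟨x, hx⟩ := hc.mod_eq h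
    push_cast at hx
    have hd : ((2 * (2 * r + 2) : ℕ) : ℤ) ∣ (k : ℤ) - l :=
      ⟨x * (2 * r + 1) - (k - l) * r, by push_cast; linear_combination (2 * (r : ℤ) + 1) * hx⟩
    have := Int.eq_zero_of_abs_lt_dvd hd (by rw [abs_lt]; constructor <;> omega)
    omega
  · intro j
    obtain ⟨j', hj1, _, hj⟩ := hc.window e j
    obtain ⟨d, rfl⟩ := Nat.exists_eq_add_of_le hj1
    obtain ⟨k, _, hk2, hk⟩ := per_window (n := 2 * (2 * r + 2))
      (c := fun k => c (e + k * (2 * r + 1))) (by omega) (fun k => by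
        have := per_mul hc.per (e + k * (2 * r + 1)) (2 * r + 1)
        rw [← this]
        congr 1
        ring) 0 (d * (2 * r + 1))
    refine ⟨k, by omega, ?_⟩
    rw [hk, ← hj, ← per_mul hc.per (e + d) (d * r)]
    congr 1
    ring

/-- Parametrisation of a parity class of the cycle by steps of length `s - 1`, for `s` odd. -/
lemma param_odd (hc : Cyc G (2 * s) c) (hs : s % 2 = 1) (e : ℕ) :
    (∀ k, c (e + (k + s) * (s - 1)) = c (e + k * (s - 1))) ∧
    (∀ k l, k < s → l < s → c (e + k * (s - 1)) = c (e + l * (s - 1)) → k = l) ∧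
    (∀ d, ∃ k < s, c (e + 2 * d) = c (e + k * (s - 1))) := by
  have h3 := hc.three
  obtain ⟨r, rfl⟩ : ∃ r, s = 2 * r + 3 := ⟨s / 2 - 1, by omega⟩
  rw [show 2 * r + 3 - 1 = 2 * r + 2 by omega]
  have hper : ∀ k, c (e + (k + (2 * r + 3)) * (2 * r + 2)) = c (e + k * (2 * r + 2)) := by
    intro k
    have := per_mul hc.per (e + k * (2 * r + 2)) (r + 1)
    rw [← this]
    congr 1
    ring
  refine ⟨hper, ?_, ?_⟩
  · intro k l hk hl h
    obtain ⟨x, hx⟩ := hc.mod_eq h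
    push_cast at hx
    have hd : ((2 * r + 3 : ℕ) : ℤ) ∣ (k : ℤ) - l :=
      ⟨(k - l) - 2 * x, by push_cast; linear_combination - hx⟩
    have := Int.eq_zero_of_abs_lt_dvd hd (by rw [abs_lt]; constructor <;> omega)
    omega
  · intro d
    obtain ⟨k, _, hk2, hk⟩ := per_window (n := 2 * r + 3)
      (c := fun k => c (e + k * (2 * r + 2))) (by omega) hper 0 (4 * (r + 1) * d)
    refine ⟨k, by omega, ?_⟩
    rw [hk, ← per_mul hc.per (e + 2 * d) ((2 * r + 1) * d)]
    congr 1
    ring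

lemma col_path {Y : Set V} (κ : V → Fin 2) (hκ : ∀ a ∈ Y, ∀ b ∈ Y, G.Adj a b → κ a ≠ κ b)
    {x y : V} (p : G.Walk x y) (hp : ∀ v ∈ p.support, v ∈ Y) :
    κ x = κ y ↔ p.length % 2 = 0 := by
  induction p with
  | nil => simp
  | @cons u v w h p ih =>
    have h1 := ih (fun v hv => hp v (by simp [hv]))
    have h2 := hκ u (hp u (by simp)) v (hp v (by simp)) h
    rw [SimpleGraph.Walk.length_cons]
    have key : κ u = κ w ↔ ¬ κ v = κ w := by
      generalize κ u = a, κ v = b, κ w = d at h2 ⊢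
      revert a b d
      decide
    rw [key, h1]
    omega

lemma bip_or_odd (Y : Set V) :
    (∃ κ : V → Fin 2, ∀ a ∈ Y, ∀ b ∈ Y, G.Adj a b → κ a ≠ κ b) ∨
    ∃ n c, n % 2 = 1 ∧ Cyc G n c ∧ ∀ i, c i ∈ Y := by
  classical
  by_cases hcol : (G.induce Y).Colorable 2
  · left
    obtain ⟨f⟩ := hcol
    refine ⟨fun v => if h : v ∈ Y then f ⟨v, h⟩ else 0, fun a ha b hb hab => ?_⟩
    simp only [ha, hb, dif_pos]
    exact f.valid hab
  · right
    rw [SimpleGraph.two_colorable_iff_forall_loop_even] at hcol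
    push Not at hcol
    obtain ⟨u, w, hw⟩ := hcol
    rw [Nat.not_even_iff] at hw
    set w' := w.map (SimpleGraph.Embedding.induce Y).toHom with hw'
    have hl : w'.length = w.length := SimpleGraph.Walk.length_map _ _
    obtain ⟨h1, h2⟩ := closed_walk w' (by omega)
    refine odd_cyc w'.length (fun i => w'.getVert (i % w'.length)) (by omega) h1 h2 (fun i => ?_)
    have := w'.getVert_mem_support (i % w'.length)
    rw [hw', SimpleGraph.Walk.support_map, List.mem_map] at this
    obtain ⟨a, _, ha⟩ := this
    change w'.getVert (i % w'.length) ∈ Y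
    rw [hw', ← ha]
    exact a.2

end final

section main

variable {H : Set V} {s : ℕ} {c : ℕ → V}

lemma Cyc.range_ncard [Finite V] {n : ℕ} {c : ℕ → V} (h : Cyc G n c) :
    3 ≤ (Set.range c).ncard := by
  have h3 := h.three
  have h1 : ({c 0, c 1, c 2} : Set V).ncard = 3 := Set.ncard_eq_three.2
    ⟨c 0, c 1, c 2, h.inj 0 1 (by omega) (by omega), h.inj 0 2 (by omega) (by omega),
      h.inj 1 2 (by omega) (by omega), rfl⟩
  rw [← h1]
  refine Set.ncard_le_ncard ?_ (Set.toFinite _)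
  rintro v (rfl | rfl | rfl) <;> exact ⟨_, rfl⟩

lemma odd_value (hn : ¬ HasTwoConsecEvenCycles G) (hc : Cyc G (2 * s) c) (hHc : ∀ j, c j ∉ H)
    {B : Set V} {π : V → V} (hr : Retr G H B π) (e : ℕ)
    (hT : ∀ k, ∃ h ∈ H, G.Adj h (c (e + k * (s - 1)))) :
    ∃ w, ∀ k, ∀ h ∈ H, G.Adj h (c (e + k * (s - 1))) → π h = w := by
  have hst : ∀ k, ∀ h ∈ H, ∀ h' ∈ H, G.Adj h (c (e + k * (s - 1))) →
      G.Adj h' (c (e + (k + 1) * (s - 1))) → π h = π h' := by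
    intro k h hh h' hh' h1 h2
    rw [show e + (k + 1) * (s - 1) = e + k * (s - 1) + (s - 1) by ring] at h2
    exact att_step hn hc hHc hr hh hh' h1 h2
  obtain ⟨g, hg, hga⟩ := hT 1
  refine ⟨π g, fun k => ?_⟩
  induction k with
  | zero => exact fun h hh ha => hst 0 h hh g hg ha hga
  | succ k ih =>
    intro h hh ha
    obtain ⟨g', hg', hga'⟩ := hT k
    rw [← hst k g' hg' h hh hga' ha]
    exact ih g' hg' hga'

/-- If the fibre is bipartite we are done. -/
lemma bip_win (hn : ¬ HasTwoConsecEvenCycles G) (hc : Cyc G (2 * s) c) (hHc : ∀ j, c j ∉ H)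
    (hs : s % 2 = 1)
    {B : Set V} {π : V → V} (hr : Retr G H B π) (e : ℕ) (w : V)
    (hT : ∀ k, ∃ h ∈ H, G.Adj h (c (e + k * (s - 1))))
    (hw : ∀ k, ∀ h ∈ H, G.Adj h (c (e + k * (s - 1))) → π h = w)
    (κ : V → Fin 2) (hκ : ∀ a ∈ {v | v ∈ H ∧ π v = w}, ∀ b ∈ {v | v ∈ H ∧ π v = w},
      G.Adj a b → κ a ≠ κ b) : False := by
  classical
  have hf : ∀ v, ∃ h, (∃ h ∈ H, G.Adj h v) → h ∈ H ∧ G.Adj h v := by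
    intro v
    by_cases h : ∃ h ∈ H, G.Adj h v
    · obtain ⟨g, hg⟩ := h
      exact ⟨g, fun _ => hg⟩
    · exact ⟨v, fun h' => absurd h' h⟩
  choose f hf using hf
  have hy : ∀ k, f (c (e + k * (s - 1))) ∈ H ∧
      G.Adj (f (c (e + k * (s - 1)))) (c (e + k * (s - 1))) := fun k => hf _ (hT k)
  have hne : ∀ k, κ (f (c (e + k * (s - 1)))) ≠ κ (f (c (e + (k + 1) * (s - 1)))) := by
    intro k heq
    have hk := hy k
    have hk1 := hy (k + 1)
    have e1 := hw k _ hk.1 hk.2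
    have e2 := hw (k + 1) _ hk1.1 hk1.2
    obtain ⟨n, p, hp, hl, hS⟩ := (hr.fiber_conn hk.1 hk1.1 (e1.trans e2.symm)).exists_PIn
    rw [e1] at hS
    have hlen := (col_path κ hκ p hS).1 heq
    have h2 := hk1.2
    rw [show e + (k + 1) * (s - 1) = e + k * (s - 1) + (s - 1) by ring] at h2
    have hP : PIn G H _ _ n := ⟨p, hp, hl, fun v hv => (hS v hv).1⟩
    rw [show e + (k + 1) * (s - 1) = e + k * (s - 1) + (s - 1) by ring] at hP
    exact hn (win hc hHc hP hk.2 h2 (by omega))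
  have hall : ∀ k, κ (f (c (e + k * (s - 1)))) = κ (f (c (e + 0 * (s - 1)))) ↔ k % 2 = 0 := by
    intro k
    induction k with
    | zero => simp
    | succ k ih =>
      have h1 := hne k
      have key : ∀ a b d : Fin 2, a ≠ b → (b = d ↔ ¬ a = d) := by decide
      rw [key _ _ _ h1, ih]
      omega
  have h1 := (param_odd hc hs e).1 0
  rw [Nat.zero_add] at h1
  have := (hall s).1 (by rw [h1])
  omega

lemma descent [Finite V] (h3 : KConnected 3 G) (hn : ¬ HasTwoConsecEvenCycles G)
    (hc : Cyc G (2 * s) c) (hHc : ∀ j, c j ∉ H)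
    (hHa : ∀ h ∈ H, ∀ v, G.Adj h v → v ∈ H ∨ ∃ j, v = c j)
    (hH : ∀ x ∈ H, ∀ y ∈ H, WIn G H x y) (hs : s % 2 = 1) (e e1 : ℕ) (X : Set V)
    (hcl : ∀ j, (∃ k < s, c j = c (e + k * (s - 1))) ∨ ∃ k, c j = c (e1 + k * (s - 1)))
    (hT : ∀ k, ∃ h ∈ H, G.Adj h (c (e1 + k * (s - 1))))
    (hX : ∀ π, (∃ B, Retr G H B π) → ∃ w q, (∀ x ∈ X, x = q) ∧
      ∀ k < s, ∀ h ∈ H, G.Adj h (c (e + k * (s - 1))) → c (e + k * (s - 1)) ∉ X →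
        π h = w ∨ π h = q) (n : ℕ) :
    ∀ B π w, Retr G H B π → 3 ≤ B.ncard →
      (∀ k, ∀ h ∈ H, G.Adj h (c (e1 + k * (s - 1))) → π h = w) →
      {v | v ∈ H ∧ π v = w}.ncard = n → False := by
  induction n using Nat.strong_induction_on with
  | _ n ih =>
    intro B π w hr hB hw hcard
    -- an attachment outside the fibre
    have claimY : ∃ k < s, ∃ h ∈ H, G.Adj h (c (e + k * (s - 1))) ∧ c (e + k * (s - 1)) ∉ X ∧
        π h ≠ w := by
      by_contra hcon
      push Not at hcon
      obtain ⟨w3, q, hXq, _⟩ := hX π ⟨B, hr⟩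
      refine noCut h3 hc hHc hHa hr hB w q fun h hh j ha _ hjq => Or.inl ?_
      rcases hcl j with ⟨k, hk, hjk⟩ | ⟨k, hjk⟩
      · rw [hjk] at ha hjq
        exact hcon k hk h hh ha (fun hx => hjq (hXq _ hx))
      · rw [hjk] at ha
        exact hw k h hh ha
    rcases bip_or_odd (G := G) {v | v ∈ H ∧ π v = w} with ⟨κ, hκ⟩ | ⟨n2, c2, hn2, hc2, hY2⟩
    · exact bip_win hn hc hHc hs hr e1 w hT hw κ hκ
    obtain ⟨B2, π2, hD2, hr2⟩ := exists_retr hH (D := Set.range c2)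
      (by rintro v ⟨i, rfl⟩; exact (hY2 i).1) (Rich.of_cyc hc2 hn2) ⟨_, 0, rfl⟩
    have hB2 : 3 ≤ B2.ncard :=
      hc2.range_ncard.trans (Set.ncard_le_ncard hD2 (Set.toFinite _))
    have h20 := hc2.three
    have h01 := hc2.inj 0 1 (by omega) (by omega)
    have hdisj : ∀ v ∈ B, v ∉ B2 := by
      refine hr.disj hr2 fun hsub => h01 ?_
      have a0 := hr.fix _ (hsub (hD2 ⟨0, rfl⟩))
      have a1 := hr.fix _ (hsub (hD2 ⟨1, rfl⟩))
      rw [← a0, ← a1, (hY2 0).2, (hY2 1).2]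
    have hB2Y : ∀ v ∈ B2, π v = w := by
      intro v hv
      by_cases hv0 : v = c2 0
      · rw [hv0]; exact (hY2 0).2
      obtain ⟨_, _, hp⟩ := hr2.rich v hv (c2 0) (hD2 ⟨0, rfl⟩) hv0 0
      rw [hr.const hr2.sub (fun v hv hv' => hdisj v hv' hv) hp.toWIn]
      exact (hY2 0).2
    have hwB : w ∈ B := (hY2 0).2 ▸ hr.mem _ (hY2 0).1
    have hout : ∀ h ∈ H, π h ≠ w → π2 h = π2 w := by
      intro h hh hne
      have g1 := hr2.const (S := {v | v ∈ H ∧ π v = π h}) (fun v hv => hv.1)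
        (fun v hv hv' => hne (hv.2.symm.trans (hB2Y v hv'))) (hr.fiber h hh)
      obtain ⟨_, _, hp⟩ := hr.rich _ (hr.mem h hh) w hwB hne 0
      have g2 := hr2.const hr.sub hdisj hp.toWIn
      exact g1.trans g2
    obtain ⟨u, hu⟩ := odd_value hn hc hHc hr2 e1 hT
    obtain ⟨k, hk, h, hh, ha, hkX, hne⟩ := claimY
    have hne2 : π2 w ≠ u := by
      intro heq
      obtain ⟨w3, q, hXq, hcov⟩ := hX π2 ⟨B2, hr2⟩
      have hc1 := hcov k hk h hh ha hkX
      rw [hout h hh hne, heq] at hc1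
      refine noCut h3 hc hHc hHa hr2 hB2 w3 q fun g hg j hga _ hjq => ?_
      rcases hcl j with ⟨l, hl, hjl⟩ | ⟨l, hjl⟩
      · rw [hjl] at hga hjq
        exact hcov l hl g hg hga (fun hx => hjq (hXq _ hx))
      · rw [hjl] at hga
        rw [hu l g hg hga]
        exact hc1
    refine ih _ ?_ B2 π2 u hr2 hB2 hu rfl
    rw [← hcard]
    refine Set.ncard_lt_ncard ⟨?_, fun hsub => h01 ?_⟩ (Set.toFinite _)
    · rintro v ⟨hv1, hv2⟩
      refine ⟨hv1, ?_⟩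
      by_contra hvw
      exact hne2 ((hout v hv1 hvw).symm.trans hv2)
    · have a0 := (hsub (hY2 0)).2
      have a1 := (hsub (hY2 1)).2
      rw [hr2.fix _ (hD2 ⟨0, rfl⟩)] at a0
      rw [hr2.fix _ (hD2 ⟨1, rfl⟩)] at a1
      rw [a0, a1]

/-- The main argument for an optimal even cycle. -/
lemma Opt.final [Finite V] (h3 : KConnected 3 G) {D C : Set V} {z : V} (ho : Opt G D z C)
    (hR : Rich G D) (hD3 : 3 ≤ D.ncard) : HasTwoConsecEvenCycles G := by
  by_contra hn
  obtain ⟨s, c, hc, hC⟩ := ho.ev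
  have h2s := hc.three
  set H := HH G z C with hHdef
  have hHc : ∀ j, c j ∉ H := fun j hj => HH_disj hj (hC ▸ ⟨j, rfl⟩)
  have hHa : ∀ h ∈ H, ∀ v, G.Adj h v → v ∈ H ∨ ∃ j, v = c j := by
    intro h hh v hv
    by_cases hvC : v ∈ C
    · rw [hC] at hvC
      obtain ⟨j, hj⟩ := hvC
      exact Or.inr ⟨j, hj.symm⟩
    · exact Or.inl (HH_adj hh hv hvC)
  have hH : ∀ x ∈ H, ∀ y ∈ H, WIn G H x y := fun x hx y hy => HH_conn hx hy
  obtain ⟨B, π, hDB, hr⟩ := exists_retr hH ho.sub hR ⟨z, ho.hz⟩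
  have hB : 3 ≤ B.ncard := hD3.trans (Set.ncard_le_ncard hDB (Set.toFinite _))
  obtain ⟨e, e', he1, he2, hep, hemp, hun⟩ := ho.empties h3 hc hC
  have hst : ∀ π, (∃ B, Retr G H B π) → ∀ k, ∀ h ∈ H, ∀ h' ∈ H, G.Adj h (c (e + k * (s - 1))) →
      G.Adj h' (c (e + (k + 1) * (s - 1))) → π h = π h' := by
    rintro π ⟨B, hr⟩ k h hh h' hh' h1 h2
    rw [show e + (k + 1) * (s - 1) = e + k * (s - 1) + (s - 1) by ring] at h2
    exact att_step hn hc hHc hr hh hh' h1 h2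
  have hruns : ∀ N, 3 ≤ N → ∀ m < N, c e' = c (e + m * (s - 1)) →
      (∀ k l, k < N → l < N → c (e + k * (s - 1)) = c (e + l * (s - 1)) → k = l) →
      ∃ X : Set V, ∀ π, (∃ B, Retr G H B π) → ∃ w q, (∀ x ∈ X, x = q ∨ (N = 4 ∧ x = w)) ∧
      ∀ k < N, ∀ h ∈ H, G.Adj h (c (e + k * (s - 1))) → c (e + k * (s - 1)) ∉ X →
        π h = w ∨ π h = q := by
    intro N hN m hm hem hinj
    rcases hemp with hemp | hemp
    · refine runs (p := fun k => c (e + k * (s - 1))) _ hN hm hst (by simpa using hemp) ?_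
      intro k hk0 hkN hkm
      by_contra hcon
      push Not at hcon
      rcases hun _ hcon with h | h
      · have := hinj k 0 hkN (by omega) (by simpa using h)
        omega
      · exact hkm (hinj k m hkN hm (h.trans hem))
    · refine ⟨∅, fun π hπ => ?_⟩
      obtain ⟨B, hr⟩ := hπ
      obtain ⟨w, hw⟩ := odd_value hn hc hHc hr e (fun k => hemp _)
      exact ⟨w, w, by simp, fun k _ h hh ha _ => Or.inl (hw k h hh ha)⟩
  rcases Nat.mod_two_eq_zero_or_one s with hs | hs
  · obtain ⟨hinj, hsurj⟩ := param_even hc hs e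
    obtain ⟨m, hm, hem⟩ := hsurj e'
    obtain ⟨X, hX⟩ := hruns (2 * s) h2s m hm hem hinj
    obtain ⟨w, q, hXq, hcov⟩ := hX π ⟨B, hr⟩
    refine noCut h3 hc hHc hHa hr hB w q fun h hh j ha hjw hjq => ?_
    obtain ⟨k, hk, hjk⟩ := hsurj j
    rw [hjk] at ha hjw hjq
    refine hcov k hk h hh ha fun hx => ?_
    rcases hXq _ hx with h | h
    · exact hjq h
    · exact hjw h.2
  · obtain ⟨_, hinj, hsurj⟩ := param_odd hc hs e
    obtain ⟨_, _, hsurj'⟩ := param_odd hc hs (e + 1)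
    obtain ⟨m, hm, hem⟩ := hsurj ((e' - e) / 2)
    rw [show e + 2 * ((e' - e) / 2) = e' by omega] at hem
    obtain ⟨X, hX⟩ := hruns s (by omega) m hm hem hinj
    have hT : ∀ k, ∃ h ∈ H, G.Adj h (c (e + 1 + k * (s - 1))) := by
      intro k
      by_contra hcon
      push Not at hcon
      obtain ⟨r, hr⟩ : ∃ r, k * (s - 1) = 2 * r := by
        obtain ⟨t, ht⟩ : ∃ t, s - 1 = 2 * t := ⟨(s - 1) / 2, by omega⟩
        exact ⟨k * t, by rw [ht]; ring⟩
      rcases hun _ hcon with h | h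
      · have := hc.mod_eq h
        push_cast at this
        obtain ⟨x, hx⟩ := this
        have hr' : (k : ℤ) * ((s - 1 : ℕ) : ℤ) = 2 * r := by exact_mod_cast hr
        rw [hr'] at hx
        have hx' : 1 + 2 * (r : ℤ) = 2 * (s * x) := by linarith
        omega
      · have := hc.mod_eq h
        push_cast at this
        obtain ⟨x, hx⟩ := this
        have hr' : (k : ℤ) * ((s - 1 : ℕ) : ℤ) = 2 * r := by exact_mod_cast hr
        rw [hr'] at hx
        have hx' : (e : ℤ) + 1 + 2 * (r : ℤ) - e' = 2 * (s * x) := by linarith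
        omega
    obtain ⟨w, hw⟩ := odd_value hn hc hHc hr (e + 1) hT
    refine descent h3 hn hc hHc hHa hH hs e (e + 1) X ?_ hT ?_ _ B π w hr hB hw rfl
    · intro j
      obtain ⟨j', hj1, _, hj⟩ := hc.window e j
      rw [← hj]
      by_cases hpar : (j' - e) % 2 = 0
      · left
        have := hsurj ((j' - e) / 2)
        rwa [show e + 2 * ((j' - e) / 2) = j' by omega] at this
      · right
        obtain ⟨k, _, hk⟩ := hsurj' ((j' - e) / 2)
        rw [show e + 1 + 2 * ((j' - e) / 2) = j' by omega] at hk
        exact ⟨k, hk⟩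
    · intro π hπ
      obtain ⟨w, q, h1, h2⟩ := hX π hπ
      exact ⟨w, q, fun x hx => (h1 x hx).resolve_right fun h => by omega, h2⟩

end main

end ConsecEven

open ConsecEven

/-- A 3-connected graph with two vertex-disjoint cycles, one even and one odd,
contains two cycles of consecutive even lengths. -/
theorem stmt_7 {V : Type*} [Fintype V] (G : SimpleGraph V) (h3 : KConnected 3 G)
    {x z : V} (b : G.Walk x x) (d : G.Walk z z) (hb : b.IsCycle) (hd : d.IsCycle)
    (hbe : Even b.length) (hdo : Odd d.length)
    (hdisj : ∀ v ∈ b.support, v ∉ d.support) :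
    HasTwoConsecEvenCycles G := by
  classical
  obtain ⟨hc, hcs⟩ := Cyc.of_walk d hd
  set D : Set V := {v | v ∈ d.support} with hDdef
  have hDr : D = Set.range (fun i => d.getVert (i % d.length)) := by
    ext v
    change v ∈ d.support ↔ _
    rw [hcs v]
    simp only [Set.mem_range, eq_comm]
  obtain ⟨C, ⟨hC1, hC2⟩, hmax⟩ := Set.exists_max_image
    {C : Set V | EvenCyc G C ∧ ∀ v ∈ D, v ∉ C} (fun C => (HH G z C).ncard) (Set.toFinite _)
    ⟨{v | v ∈ b.support}, EvenCyc.of_walk b hb (Nat.even_iff.1 hbe),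
      fun v hv hv' => hdisj v hv' hv⟩
  have ho : Opt G D z C := by
    refine ⟨hC1, hC2, fun C' h1 h2 => hmax C' ⟨h1, h2⟩, d.start_mem_support, fun v hv => ?_⟩
    exact WIn.of_walk (d.takeUntil v hv) fun u hu => d.support_takeUntil_subset_support hv hu
  refine ho.final h3 ?_ ?_
  · rw [hDr]
    exact Rich.of_cyc hc (Nat.odd_iff.1 hdo)
  · rw [hDr]
    exact hc.range_ncard
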